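/- Let Q=(0,1)² and fix a constant M>2. For every n ∈ ℕ with n ≥ 1, the set A'_n := {f ∈ X : there exists E ⊆ Q, a finite union of pairwise disjoint open triangles, with |E| < 1/n and Var(f,E) > 1/2 − 1/n} is open and dense in the metric space (X,d). -/

import Mathlib

open MeasureTheory Set
open scoped ENNReal

noncomputable section

abbrev Plane := EuclideanSpace ℝ (Fin 2)

/-- The open unit square `(0,1)²`. -/
def unitSq : Set Plane := {x | 0 < x 0 ∧ x 0 < 1 ∧ 0 < x 1 ∧ x 1 < 1}

/-- Standard basis vectors of the plane. -/
def e2 (i : Fin 2) : Plane := EuclideanSpace.single i 1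

/-- The set of approximating values in the definition of the variation of `f` on `U`:
integrals against `C¹_c` test fields `φ = (φ₁, φ₂)` all of whose four components are
bounded by `1` in absolute value. -/
def varSet (f : Plane → Plane) (U : Set Plane) : Set ℝ :=
  {v | ∃ φ : Plane → Plane × Plane,
    ContDiff ℝ 1 φ ∧ HasCompactSupport φ ∧ tsupport φ ⊆ U ∧
    (∀ x i, |(φ x).1 i| ≤ 1 ∧ |(φ x).2 i| ≤ 1) ∧
    v = ∫ x in U, ((f x 0) * (fderiv ℝ (fun y => (φ y).1 0) x (e2 0)
                    + fderiv ℝ (fun y => (φ y).1 1) x (e2 1))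
        + (f x 1) * (fderiv ℝ (fun y => (φ y).2 0) x (e2 0)
                    + fderiv ℝ (fun y => (φ y).2 1) x (e2 1)))}

/-- The variation of `f` in `U`. -/
def Var (f : Plane → Plane) (U : Set Plane) : ℝ := sSup (varSet f U)

/-- `f` is a `BV` map on `U`. -/
def IsBV (f : Plane → Plane) (U : Set Plane) : Prop :=
  IntegrableOn f U volume ∧ BddAbove (varSet f U)

/-- `f` is a homeomorphism of `U` onto `V`, with inverse `g`. -/
def IsHomeoOn (f g : Plane → Plane) (U V : Set Plane) : Prop :=
  BijOn f U V ∧ ContinuousOn f U ∧ InvOn g f U V ∧ ContinuousOn g V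

/-- `f` (as a total function, representing its own continuous extension) extends
continuously to the closure of the unit square, with `f = Id` on the boundary. -/
def ExtendsToId (f : Plane → Plane) : Prop :=
  ContinuousOn f (closure unitSq) ∧ EqOn f id (frontier unitSq)

/-- The space `X` of `BV` homeomorphisms of the unit square fixing the boundary with
variation smaller than `M`; an element is a pair (homeomorphism, inverse). -/
def X (M : ℝ) : Set ((Plane → Plane) × (Plane → Plane)) :=
  {p | IsHomeoOn p.1 p.2 unitSq unitSq ∧ ExtendsToId p.1 ∧
    IsBV p.1 unitSq ∧ Var p.1 unitSq < M}

/-- Sup distance `‖f - g‖_∞` over the set `U`. -/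
def supDist (f g : Plane → Plane) (U : Set Plane) : ℝ := ⨆ x : U, dist (f x) (g x)

/-- The distance `d` on `X`. -/
def dX (M : ℝ) (p q : (Plane → Plane) × (Plane → Plane)) : ℝ :=
  supDist p.1 q.1 unitSq + supDist p.2 q.2 unitSq +
    |1 / (M - Var p.1 unitSq) - 1 / (M - Var q.1 unitSq)|

/-- `A` is open in the metric space `(X, d)`. -/
def OpenInX (M : ℝ) (A : Set ((Plane → Plane) × (Plane → Plane))) : Prop :=
  A ⊆ X M ∧ ∀ p ∈ A, ∃ ε > 0, ∀ q ∈ X M, dX M p q < ε → q ∈ A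

/-- `A` is dense in the metric space `(X, d)`. -/
def DenseInX (M : ℝ) (A : Set ((Plane → Plane) × (Plane → Plane))) : Prop :=
  A ⊆ X M ∧ ∀ p ∈ X M, ∀ ε > 0, ∃ q ∈ A, dX M p q < ε

/-- An open triangle in the plane. -/
def IsOpenTriangle (T : Set Plane) : Prop :=
  ∃ a b c : Plane, T = interior (convexHull ℝ {a, b, c})

/-- A finite union of pairwise disjoint open triangles. -/
def FinUnionTriangles (E : Set Plane) : Prop :=
  ∃ (k : ℕ) (T : Fin k → Set Plane), (∀ i, IsOpenTriangle (T i)) ∧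
    (∀ i j, i ≠ j → Disjoint (T i) (T j)) ∧ E = ⋃ i, T i

/-- The set `A` of homeomorphisms mapping a null set onto a set of full measure. -/
def Afull (M : ℝ) : Set ((Plane → Plane) × (Plane → Plane)) :=
  {p ∈ X M | ∃ E ⊆ unitSq, volume E = 0 ∧ volume (p.1 '' E) = 1}

/-- The set `A_n`. -/
def An (M : ℝ) (n : ℕ) : Set ((Plane → Plane) × (Plane → Plane)) :=
  {p ∈ X M | ∃ E ⊆ unitSq, FinUnionTriangles E ∧
    volume E < 1 / (n : ℝ≥0∞) ∧ 1 - 1 / (n : ℝ≥0∞) < volume (p.1 '' E)}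

/-- The set `A'_n` of elements of `X` having large variation on a finite union of
pairwise disjoint open triangles of small measure. -/
def An' (M : ℝ) (n : ℕ) : Set ((Plane → Plane) × (Plane → Plane)) :=
  {p ∈ X M | ∃ E ⊆ unitSq, FinUnionTriangles E ∧
    volume E < 1 / (n : ℝ≥0∞) ∧ (1 / 2 - 1 / n : ℝ) < Var p.1 E}

/-- The partial derivative of a scalar function on the plane. -/
def pd (i : Fin 2) (F : Plane → ℝ) (x : Plane) : ℝ := fderiv ℝ F x (e2 i)

/-- A matrix of scalar `C¹` functions, jointly supported in a compact subset of `U`. -/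
structure IsTest (U : Set Plane) (p : Fin 2 → Fin 2 → Plane → ℝ) : Prop where
  smooth : ∀ i j, ContDiff ℝ 1 (p i j)
  supp : ∃ K, IsCompact K ∧ K ⊆ U ∧ ∀ i j, ∀ x ∉ K, p i j x = 0

/-- The row divergence of a matrix of scalar functions. -/
def rowDiv (p : Fin 2 → Fin 2 → Plane → ℝ) (i : Fin 2) (x : Plane) : ℝ :=
  pd 0 (p i 0) x + pd 1 (p i 1) x

/-- The integrand in the definition of the variation. -/
def pairingFun (f : Plane → Plane) (p : Fin 2 → Fin 2 → Plane → ℝ) (x : Plane) : ℝ :=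
  f x 0 * rowDiv p 0 x + f x 1 * rowDiv p 1 x

/-- The integral of `f` against the row divergence of a test matrix. -/
def pairing (f : Plane → Plane) (p : Fin 2 → Fin 2 → Plane → ℝ) (U : Set Plane) : ℝ :=
  ∫ x in U, pairingFun f p x

lemma mem_varSet_iff (f : Plane → Plane) (U : Set Plane) (v : ℝ) :
    v ∈ varSet f U ↔ ∃ p, IsTest U p ∧ (∀ i j x, |p i j x| ≤ 1) ∧ v = pairing f p U := by
  constructor
  · rintro ⟨φ, hφ, hc, hs, hb, rfl⟩
    refine ⟨fun i j x => if i = 0 then (φ x).1 j else (φ x).2 j, ⟨?_, tsupport φ, hc, hs, ?_⟩,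
      ?_, ?_⟩
    · intro i j
      fin_cases i
      · exact contDiff_euclidean.1 hφ.fst j
      · exact contDiff_euclidean.1 hφ.snd j
    · intro i j x hx
      have : φ x = 0 := image_eq_zero_of_notMem_tsupport hx
      simp [this]
    · intro i j x
      fin_cases i
      · exact (hb x j).1
      · exact (hb x j).2
    · rfl
  · rintro ⟨p, ⟨hsm, K, hK, hKU, hp⟩, hb, rfl⟩
    have hsupp : tsupport (fun x => ((WithLp.toLp 2 fun j => p 0 j x : Plane),
        (WithLp.toLp 2 fun j => p 1 j x : Plane))) ⊆ K := by
      refine closure_minimal ?_ hK.isClosed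
      intro x hx
      by_contra hxK
      refine hx ?_
      simp only [hp _ _ x hxK]
      rfl
    refine ⟨fun x => (WithLp.toLp 2 fun j => p 0 j x, WithLp.toLp 2 fun j => p 1 j x),
      ?_, ?_, ?_, ?_, ?_⟩
    · exact (contDiff_euclidean.2 fun j => hsm 0 j).prodMk (contDiff_euclidean.2 fun j => hsm 1 j)
    · exact hK.of_isClosed_subset (isClosed_tsupport _) hsupp
    · exact hsupp.trans hKU
    · exact fun x i => ⟨hb 0 i x, hb 1 i x⟩
    · rfl

lemma pd_eq_zero {K : Set Plane} (hK : IsClosed K) {F : Plane → ℝ} (hF : ∀ x ∉ K, F x = 0)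
    (i : Fin 2) {x : Plane} (hx : x ∉ K) : pd i F x = 0 := by
  have : F =ᶠ[nhds x] fun _ => (0 : ℝ) := by
    filter_upwards [hK.isOpen_compl.mem_nhds hx] with y hy using hF y hy
  rw [pd, this.fderiv_eq]
  simp

lemma continuous_pd {F : Plane → ℝ} (hF : ContDiff ℝ 1 F) (i : Fin 2) : Continuous (pd i F) :=
  (hF.continuous_fderiv one_ne_zero).clm_apply continuous_const

lemma IsTest.continuous_rowDiv {U : Set Plane} {p : Fin 2 → Fin 2 → Plane → ℝ}
    (hp : IsTest U p) (i : Fin 2) : Continuous (rowDiv p i) :=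
  (continuous_pd (hp.smooth i 0) 0).add (continuous_pd (hp.smooth i 1) 1)

lemma IsTest.rowDiv_eq_zero {U : Set Plane} {p : Fin 2 → Fin 2 → Plane → ℝ}
    (hp : IsTest U p) : ∃ K, IsCompact K ∧ K ⊆ U ∧ ∀ i, ∀ x ∉ K, rowDiv p i x = 0 := by
  obtain ⟨K, hK, hKU, h⟩ := hp.supp
  refine ⟨K, hK, hKU, fun i x hx => ?_⟩
  rw [rowDiv, pd_eq_zero hK.isClosed (h i 0) 0 hx, pd_eq_zero hK.isClosed (h i 1) 1 hx, add_zero]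

lemma IsTest.rowDiv_hasCompactSupport {U : Set Plane} {p : Fin 2 → Fin 2 → Plane → ℝ}
    (hp : IsTest U p) (i : Fin 2) : HasCompactSupport (rowDiv p i) := by
  obtain ⟨K, hK, -, h⟩ := hp.rowDiv_eq_zero
  exact HasCompactSupport.intro hK (h i)

lemma IsTest.integrable_rowDiv {U : Set Plane} {p : Fin 2 → Fin 2 → Plane → ℝ}
    (hp : IsTest U p) (i : Fin 2) : Integrable (rowDiv p i) :=
  (hp.continuous_rowDiv i).integrable_of_hasCompactSupport (hp.rowDiv_hasCompactSupport i)

lemma IsTest.mono {U V : Set Plane} (h : U ⊆ V) {p : Fin 2 → Fin 2 → Plane → ℝ}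
    (hp : IsTest U p) : IsTest V p :=
  ⟨hp.smooth, hp.supp.imp fun _ hK => ⟨hK.1, hK.2.1.trans h, hK.2.2⟩⟩

lemma pairing_eq_integral {U : Set Plane} (f : Plane → Plane) {p : Fin 2 → Fin 2 → Plane → ℝ}
    (hp : IsTest U p) : pairing f p U = ∫ x, pairingFun f p x := by
  obtain ⟨K, -, hKU, h⟩ := hp.rowDiv_eq_zero
  refine setIntegral_eq_integral_of_forall_compl_eq_zero fun x hx => ?_
  have hxK : x ∉ K := fun hxK => hx (hKU hxK)
  simp [pairingFun, h _ x hxK]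

lemma pairing_eq_of_subset {U V : Set Plane} (h : U ⊆ V) (f : Plane → Plane)
    {p : Fin 2 → Fin 2 → Plane → ℝ} (hp : IsTest U p) : pairing f p U = pairing f p V := by
  rw [pairing_eq_integral f hp, pairing_eq_integral f (hp.mono h)]

lemma varSet_subset {U V : Set Plane} (h : U ⊆ V) (f : Plane → Plane) :
    varSet f U ⊆ varSet f V := by
  intro v hv
  obtain ⟨p, hp, hb, rfl⟩ := (mem_varSet_iff f U v).1 hv
  exact (mem_varSet_iff f V _).2 ⟨p, hp.mono h, hb, pairing_eq_of_subset h f hp⟩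

lemma zero_mem_varSet (f : Plane → Plane) (U : Set Plane) : (0 : ℝ) ∈ varSet f U := by
  refine (mem_varSet_iff f U 0).2 ⟨fun _ _ _ => 0, ⟨fun _ _ => contDiff_const, ∅,
    isCompact_empty, empty_subset _, fun _ _ _ _ => rfl⟩, by simp, ?_⟩
  simp [pairing, pairingFun, rowDiv, pd]

lemma integrable_mul_rowDiv {f : Plane → Plane} {U V : Set Plane} (hf : IntegrableOn f U)
    {p : Fin 2 → Fin 2 → Plane → ℝ} (hp : IsTest V p) (i : Fin 2) :
    IntegrableOn (fun x => f x i * rowDiv p i x) U := by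
  obtain ⟨C, hC⟩ := (hp.continuous_rowDiv i).bounded_above_of_compact_support
    (hp.rowDiv_hasCompactSupport i)
  have h1 : IntegrableOn (fun x => f x i) U :=
    (EuclideanSpace.proj (𝕜 := ℝ) i : Plane →L[ℝ] ℝ).integrable_comp hf
  exact Integrable.mul_bdd h1 (hp.continuous_rowDiv i).aestronglyMeasurable
    (Filter.Eventually.of_forall hC)

lemma integrableOn_pairingFun {f : Plane → Plane} {U V : Set Plane} (hf : IntegrableOn f U)
    {p : Fin 2 → Fin 2 → Plane → ℝ} (hp : IsTest V p) :
    IntegrableOn (pairingFun f p) U :=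
  (integrable_mul_rowDiv hf hp 0).add (integrable_mul_rowDiv hf hp 1)

/-- Lower semicontinuity of the variation with respect to uniform convergence. -/
lemma exists_forall_dist_lt_Var {f : Plane → Plane} {U : Set Plane}
    (hf : IntegrableOn f U) {c : ℝ} (hc : c < Var f U) :
    ∃ δ > 0, ∀ g : Plane → Plane, IntegrableOn g U → BddAbove (varSet g U) →
      (∀ x ∈ U, dist (f x) (g x) < δ) → c < Var g U := by
  obtain ⟨v, hv, hcv⟩ := exists_lt_of_lt_csSup ⟨0, zero_mem_varSet f U⟩ hc
  obtain ⟨p, hp, hb, rfl⟩ := (mem_varSet_iff f U v).1 hv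
  set D : ℝ := ∫ x, (|rowDiv p 0 x| + |rowDiv p 1 x|) with hD
  have hDi : Integrable fun x => |rowDiv p 0 x| + |rowDiv p 1 x| :=
    (hp.integrable_rowDiv 0).abs.add (hp.integrable_rowDiv 1).abs
  have hD0 : 0 ≤ D := integral_nonneg fun x => by positivity
  refine ⟨(pairing f p U - c) / (2 * (1 + D)), div_pos (by linarith) (by linarith), ?_⟩
  intro g hg hgb hfg
  set δ := (pairing f p U - c) / (2 * (1 + D)) with hδ
  have hδ0 : 0 < δ := div_pos (by linarith) (by linarith)
  have hle : pairing g p U ≤ Var g U := le_csSup hgb ((mem_varSet_iff g U _).2 ⟨p, hp, hb, rfl⟩)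
  obtain ⟨K, hK, hKU, hz⟩ := hp.rowDiv_eq_zero
  have hbound : ∀ x, pairingFun f p x - pairingFun g p x ≤
      δ * (|rowDiv p 0 x| + |rowDiv p 1 x|) := by
    intro x
    by_cases hx : x ∈ K
    · have key : ∀ i, (f x i - g x i) * rowDiv p i x ≤ δ * |rowDiv p i x| := by
        intro i
        have h1 : |f x i - g x i| ≤ dist (f x) (g x) := by
          have := PiLp.norm_apply_le (f x - g x) i
          rwa [← dist_eq_norm] at this
        calc (f x i - g x i) * rowDiv p i x ≤ |(f x i - g x i) * rowDiv p i x| := le_abs_self _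
          _ = |f x i - g x i| * |rowDiv p i x| := abs_mul _ _
          _ ≤ δ * |rowDiv p i x| := by
            gcongr
            exact h1.trans (hfg x (hKU hx)).le
      have h0 := key 0
      have h1 := key 1
      simp only [pairingFun]
      linarith
    · simp [pairingFun, hz _ x hx]
  have hdiff : pairing f p U - pairing g p U ≤ δ * D := by
    have hfi := integrableOn_pairingFun hf hp
    have hgi := integrableOn_pairingFun hg hp
    rw [pairing, pairing, ← integral_sub hfi hgi, hD, ← integral_const_mul]
    calc ∫ x in U, (pairingFun f p x - pairingFun g p x)
        ≤ ∫ x in U, δ * (|rowDiv p 0 x| + |rowDiv p 1 x|) :=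
          integral_mono (hfi.sub hgi) (hDi.const_mul δ).integrableOn hbound
      _ ≤ _ := setIntegral_le_integral (hDi.const_mul δ)
          (Filter.Eventually.of_forall fun x => by positivity)
  have : δ * D < pairing f p U - c := by
    have h2 : δ * (2 * (1 + D)) = pairing f p U - c := by
      rw [hδ]; field_simp
    nlinarith
  linarith

lemma isOpen_unitSq : IsOpen unitSq := by
  have h : ∀ i, Continuous fun x : Plane => x i := fun i => by fun_prop
  exact (isOpen_lt continuous_const (h 0)).inter ((isOpen_lt (h 0) continuous_const).inter
    ((isOpen_lt continuous_const (h 1)).inter (isOpen_lt (h 1) continuous_const)))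

lemma closure_unitSq_subset :
    closure unitSq ⊆ {x | 0 ≤ x 0 ∧ x 0 ≤ 1 ∧ 0 ≤ x 1 ∧ x 1 ≤ 1} := by
  have h : ∀ i, Continuous fun x : Plane => x i := fun i => by fun_prop
  refine closure_minimal (fun x hx => ⟨hx.1.le, hx.2.1.le, hx.2.2.1.le, hx.2.2.2.le⟩) ?_
  exact (isClosed_le continuous_const (h 0)).inter ((isClosed_le (h 0) continuous_const).inter
    ((isClosed_le continuous_const (h 1)).inter (isClosed_le (h 1) continuous_const)))

lemma mem_closure_unitSq {x : Plane} (h0 : 0 ≤ x 0) (h0' : x 0 ≤ 1) (h1 : 0 ≤ x 1)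
    (h1' : x 1 ≤ 1) : x ∈ closure unitSq := by
  have hc : Continuous fun t : ℝ => x + t • (!₂[1/2, 1/2] - x : Plane) := by fun_prop
  have hmem : ∀ t ∈ Ioo (0:ℝ) 1, x + t • (!₂[1/2, 1/2] - x : Plane) ∈ unitSq := by
    rintro t ⟨ht0, ht1⟩
    simp only [unitSq, mem_ofPred_eq, PiLp.add_apply, PiLp.smul_apply, PiLp.sub_apply,
      smul_eq_mul, Matrix.cons_val_zero, Matrix.cons_val_one]
    refine ⟨?_, ?_, ?_, ?_⟩ <;> nlinarith
  have h0c : (0:ℝ) ∈ closure (Ioo (0:ℝ) 1) := by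
    rw [closure_Ioo zero_ne_one]; simp
  have := hc.continuousOn.image_closure (s := Ioo (0:ℝ) 1) ⟨0, h0c, rfl⟩
  simp only [zero_smul, add_zero] at this
  refine closure_mono ?_ this
  rintro _ ⟨t, ht, rfl⟩
  exact hmem t ht

lemma frontier_unitSq_subset {x : Plane} (hx : x ∈ frontier unitSq) :
    (x 0 = 0 ∨ x 0 = 1) ∨ (x 1 = 0 ∨ x 1 = 1) := by
  rw [isOpen_unitSq.frontier_eq] at hx
  obtain ⟨h1, h2, h3, h4⟩ := closure_unitSq_subset hx.1
  by_contra! h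
  exact hx.2 ⟨lt_of_le_of_ne h1 h.1.1.symm, lt_of_le_of_ne h2 h.1.2,
    lt_of_le_of_ne h3 h.2.1.symm, lt_of_le_of_ne h4 h.2.2⟩

lemma isCompact_closure_unitSq : IsCompact (closure unitSq) := by
  refine Metric.isCompact_of_isClosed_isBounded isClosed_closure ?_
  refine (Metric.isBounded_closedBall (x := (0 : Plane)) (r := 2)).subset fun x hx => ?_
  obtain ⟨h1, h2, h3, h4⟩ := closure_unitSq_subset hx
  rw [mem_closedBall_zero_iff, EuclideanSpace.norm_eq, Fin.sum_univ_two, Real.norm_eq_abs,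
    Real.norm_eq_abs, sq_abs, sq_abs]
  refine Real.sqrt_le_iff.2 ⟨by norm_num, by nlinarith⟩

lemma dist_le_of_mem_unitSq : ∃ C, ∀ x ∈ unitSq, ∀ y ∈ unitSq, dist x y ≤ C := by
  obtain ⟨C, hC⟩ := Metric.isBounded_iff.1 isCompact_closure_unitSq.isBounded
  exact ⟨C, fun x hx y hy => hC (subset_closure hx) (subset_closure hy)⟩

lemma dist_le_supDist {f g : Plane → Plane} (hf : MapsTo f unitSq unitSq)
    (hg : MapsTo g unitSq unitSq) {x : Plane} (hx : x ∈ unitSq) :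
    dist (f x) (g x) ≤ supDist f g unitSq := by
  obtain ⟨C, hC⟩ := dist_le_of_mem_unitSq
  refine le_ciSup (f := fun x : unitSq => dist (f x) (g x)) ⟨C, ?_⟩ ⟨x, hx⟩
  rintro _ ⟨y, rfl⟩
  exact hC _ (hf y.2) _ (hg y.2)

lemma supDist_le {f g : Plane → Plane} {C : ℝ} (hC : 0 ≤ C)
    (h : ∀ x ∈ unitSq, dist (f x) (g x) ≤ C) : supDist f g unitSq ≤ C :=
  Real.iSup_le (fun x => h x x.2) hC

lemma supDist_nonneg (f g : Plane → Plane) (U : Set Plane) : 0 ≤ supDist f g U :=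
  Real.iSup_nonneg fun _ => dist_nonneg

lemma openInX_An' (M : ℝ) (n : ℕ) : OpenInX M (An' M n) := by
  refine ⟨fun p hp => hp.1, ?_⟩
  rintro p ⟨hpX, E, hEQ, hE, hvol, hvar⟩
  obtain ⟨δ, hδ, h⟩ := exists_forall_dist_lt_Var (hpX.2.2.1.1.mono_set hEQ) hvar
  refine ⟨δ, hδ, fun q hq hd => ⟨hq, E, hEQ, hE, hvol, ?_⟩⟩
  refine h q.1 (hq.2.2.1.1.mono_set hEQ) (hq.2.2.1.2.mono (varSet_subset hEQ q.1)) ?_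
  intro x hx
  have h1 := dist_le_supDist hpX.1.1.mapsTo hq.1.1.mapsTo (hEQ hx)
  have h2 := supDist_nonneg p.2 q.2 unitSq
  have h3 := abs_nonneg (1 / (M - Var p.1 unitSq) - 1 / (M - Var q.1 unitSq))
  unfold dX at hd
  linarith

/-- The horizontal shear `(x, y) ↦ (x + χ(y) β(x), y)`. -/
def shear (β χ : ℝ → ℝ) (z : Plane) : Plane := !₂[z 0 + χ (z 1) * β (z 0), z 1]

/-- Profiles for which `shear β χ` is a diffeomorphism fixing the boundary of the unit square. -/
structure ShearProfile (β χ : ℝ → ℝ) (A κ C : ℝ) : Prop where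
  smooth_β : ContDiff ℝ 2 β
  smooth_χ : ContDiff ℝ 2 χ
  abs_β : ∀ t, |β t| ≤ A
  abs_deriv_β : ∀ t, |deriv β t| ≤ κ
  χ_nonneg : ∀ t, 0 ≤ χ t
  χ_le : ∀ t, χ t ≤ 1
  abs_deriv_χ : ∀ t, |deriv χ t| ≤ C
  lt_one : κ + C * A < 1
  β_zero : β 0 = 0
  β_one : β 1 = 0
  χ_zero : χ 0 = 0
  χ_one : χ 1 = 0

namespace ShearProfile

variable {β χ : ℝ → ℝ} {A κ C : ℝ}

protected lemma neg (h : ShearProfile β χ A κ C) : ShearProfile (fun t => -β t) χ A κ C where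
  smooth_β := h.smooth_β.neg
  smooth_χ := h.smooth_χ
  abs_β t := by simpa using h.abs_β t
  abs_deriv_β t := by
    rw [show (fun t => -β t) = -β from rfl, deriv.neg']
    simpa using h.abs_deriv_β t
  χ_nonneg := h.χ_nonneg
  χ_le := h.χ_le
  abs_deriv_χ := h.abs_deriv_χ
  lt_one := h.lt_one
  β_zero := by simp [h.β_zero]
  β_one := by simp [h.β_one]
  χ_zero := h.χ_zero
  χ_one := h.χ_one

lemma A_nonneg (h : ShearProfile β χ A κ C) : 0 ≤ A := (abs_nonneg _).trans (h.abs_β 0)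
lemma κ_nonneg (h : ShearProfile β χ A κ C) : 0 ≤ κ := (abs_nonneg _).trans (h.abs_deriv_β 0)
lemma C_nonneg (h : ShearProfile β χ A κ C) : 0 ≤ C := (abs_nonneg _).trans (h.abs_deriv_χ 0)

lemma κ_lt_one (h : ShearProfile β χ A κ C) : κ < 1 := by
  have := mul_nonneg h.C_nonneg h.A_nonneg
  linarith [h.lt_one]

lemma abs_sub_β (h : ShearProfile β χ A κ C) (s t : ℝ) : |β s - β t| ≤ κ * |s - t| :=
  Convex.norm_image_sub_le_of_norm_deriv_le (s := univ)
    (fun x _ => (h.smooth_β.differentiable two_ne_zero) x) (fun x _ => h.abs_deriv_β x)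
    convex_univ (mem_univ t) (mem_univ s)

lemma abs_sub_χ (h : ShearProfile β χ A κ C) (s t : ℝ) : |χ s - χ t| ≤ C * |s - t| :=
  Convex.norm_image_sub_le_of_norm_deriv_le (s := univ)
    (fun x _ => (h.smooth_χ.differentiable two_ne_zero) x) (fun x _ => h.abs_deriv_χ x)
    convex_univ (mem_univ t) (mem_univ s)

lemma approximatesLinearOn (h : ShearProfile β χ A κ C) :
    ApproximatesLinearOn (shear β χ) ((ContinuousLinearEquiv.refl ℝ Plane : Plane ≃L[ℝ] Plane) :
      Plane →L[ℝ] Plane) univ (Real.toNNReal (κ + C * A)) := by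
  intro x _ y _
  have h0 : 0 ≤ κ + C * A := add_nonneg h.κ_nonneg (mul_nonneg h.C_nonneg h.A_nonneg)
  rw [Real.coe_toNNReal _ h0]
  have e : shear β χ x - shear β χ y - (ContinuousLinearEquiv.refl ℝ Plane : Plane →L[ℝ] Plane)
      (x - y) = EuclideanSpace.single 0 (χ (x 1) * β (x 0) - χ (y 1) * β (y 0)) := by
    ext i
    fin_cases i
    · simp [shear]; ring
    · simp [shear]
  rw [e, PiLp.norm_single, Real.norm_eq_abs]
  have n0 : |x 0 - y 0| ≤ ‖x - y‖ := PiLp.norm_apply_le (x - y) 0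
  have n1 : |x 1 - y 1| ≤ ‖x - y‖ := PiLp.norm_apply_le (x - y) 1
  have e2 : χ (x 1) * β (x 0) - χ (y 1) * β (y 0) =
    χ (x 1) * (β (x 0) - β (y 0)) + (χ (x 1) - χ (y 1)) * β (y 0) := by ring
  rw [e2]
  calc _ ≤ |χ (x 1) * (β (x 0) - β (y 0))| + |(χ (x 1) - χ (y 1)) * β (y 0)| := abs_add_le _ _
    _ = |χ (x 1)| * |β (x 0) - β (y 0)| + |χ (x 1) - χ (y 1)| * |β (y 0)| := by
      rw [abs_mul, abs_mul]
    _ ≤ 1 * (κ * ‖x - y‖) + (C * ‖x - y‖) * A := by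
      have := h.κ_nonneg
      have := h.C_nonneg
      gcongr
      · rw [abs_of_nonneg (h.χ_nonneg _)]; exact h.χ_le _
      · exact (h.abs_sub_β _ _).trans (by gcongr)
      · exact (h.abs_sub_χ _ _).trans (by gcongr)
      · exact h.abs_β _
    _ = _ := by ring

/-- The shear as a homeomorphism of the plane. -/
def homeo (h : ShearProfile β χ A κ C) : Plane ≃ₜ Plane :=
  h.approximatesLinearOn.toHomeomorph (shear β χ) (Or.inr (by
    have : ‖((ContinuousLinearEquiv.refl ℝ Plane).symm : Plane →L[ℝ] Plane)‖₊ = 1 := by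
      rw [ContinuousLinearEquiv.refl_symm, ContinuousLinearEquiv.coe_refl]
      ext
      simp
    rw [this, inv_one]
    exact Real.toNNReal_lt_one.2 h.lt_one))

@[simp] lemma homeo_apply (h : ShearProfile β χ A κ C) (z : Plane) : h.homeo z = shear β χ z := rfl

lemma strictMono (h : ShearProfile β χ A κ C) (y : ℝ) :
    StrictMono fun t => t + χ y * β t := by
  intro s t hst
  have h1 := h.abs_sub_β s t
  have h2 := h.χ_nonneg y
  have h3 := h.χ_le y
  have h4 := h.κ_lt_one
  rw [abs_of_neg (sub_neg.2 hst)] at h1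
  have h5 : χ y * (β s - β t) ≤ |β s - β t| := by
    refine (le_abs_self _).trans ?_
    rw [abs_mul, abs_of_nonneg h2]
    exact mul_le_of_le_one_left (abs_nonneg _) h3
  simp only
  nlinarith

lemma shear_mem_iff (h : ShearProfile β χ A κ C) (z : Plane) :
    shear β χ z ∈ unitSq ↔ z ∈ unitSq := by
  have h0 := (h.strictMono (z 1)).lt_iff_lt (a := 0) (b := z 0)
  have h1 := (h.strictMono (z 1)).lt_iff_lt (a := z 0) (b := 1)
  simp only [h.β_zero, h.β_one, mul_zero, add_zero] at h0 h1
  simp only [shear, unitSq, mem_ofPred_eq, Matrix.cons_val_zero, Matrix.cons_val_one, h0, h1]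

lemma shear_frontier (h : ShearProfile β χ A κ C) {z : Plane} (hz : z ∈ frontier unitSq) :
    shear β χ z = z := by
  have : χ (z 1) * β (z 0) = 0 := by
    rcases frontier_unitSq_subset hz with (h1 | h1) | (h1 | h1) <;>
      simp [h1, h.β_zero, h.β_one, h.χ_zero, h.χ_one]
  ext i
  fin_cases i <;> simp [shear, this]

lemma dist_shear_le (h : ShearProfile β χ A κ C) (z : Plane) : dist (shear β χ z) z ≤ A := by
  have : shear β χ z - z = EuclideanSpace.single 0 (χ (z 1) * β (z 0)) := by
    ext i
    fin_cases i <;> simp [shear]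
  rw [dist_eq_norm, this, PiLp.norm_single, Real.norm_eq_abs, abs_mul,
    abs_of_nonneg (h.χ_nonneg _)]
  exact (mul_le_of_le_one_left (abs_nonneg _) (h.χ_le _)).trans (h.abs_β _)

lemma dist_symm_le (h : ShearProfile β χ A κ C) (z : Plane) : dist z (h.homeo.symm z) ≤ A := by
  have := h.dist_shear_le (h.homeo.symm z)
  rwa [← h.homeo_apply, h.homeo.apply_symm_apply] at this

lemma symm_mem_iff (h : ShearProfile β χ A κ C) (z : Plane) :
    h.homeo.symm z ∈ unitSq ↔ z ∈ unitSq := by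
  rw [← h.shear_mem_iff, ← h.homeo_apply, h.homeo.apply_symm_apply]

lemma symm_frontier (h : ShearProfile β χ A κ C) {z : Plane} (hz : z ∈ frontier unitSq) :
    h.homeo.symm z = z := by
  rw [h.homeo.symm_apply_eq, h.homeo_apply, h.shear_frontier hz]

lemma image_unitSq (h : ShearProfile β χ A κ C) : shear β χ '' unitSq = unitSq := by
  ext z
  constructor
  · rintro ⟨w, hw, rfl⟩
    exact (h.shear_mem_iff w).2 hw
  · intro hz
    exact ⟨h.homeo.symm z, (h.symm_mem_iff z).2 hz, h.homeo.apply_symm_apply z⟩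

lemma symm_mem_closure (h : ShearProfile β χ A κ C) {z : Plane} (hz : z ∈ closure unitSq) :
    h.homeo.symm z ∈ closure unitSq := by
  by_cases hz' : z ∈ unitSq
  · exact subset_closure ((h.symm_mem_iff z).2 hz')
  · have : z ∈ frontier unitSq := by
      rw [isOpen_unitSq.frontier_eq]; exact ⟨hz, hz'⟩
    rwa [h.symm_frontier this]

end ShearProfile

lemma pd_eq_of_hasDerivAt {F : Plane → ℝ} {z : Plane} (hF : DifferentiableAt ℝ F z) {i : Fin 2}
    {d : ℝ} (hd : HasDerivAt (fun t : ℝ => F (z + t • e2 i)) d 0) : pd i F z = d :=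
  (hF.hasFDerivAt.hasLineDerivAt (e2 i)).unique hd

lemma fderiv_apply_eq (F : Plane → ℝ) (x : Plane) (a b : ℝ) :
    fderiv ℝ F x (a • e2 0 + b • e2 1) = a * pd 0 F x + b * pd 1 F x := by
  simp [pd]

namespace ShearProfile

variable {β χ : ℝ → ℝ} {A κ C : ℝ}

lemma hasDerivAt_β (h : ShearProfile β χ A κ C) (t : ℝ) : HasDerivAt β (deriv β t) t :=
  ((h.smooth_β.differentiable two_ne_zero) t).hasDerivAt

lemma hasDerivAt_χ (h : ShearProfile β χ A κ C) (t : ℝ) : HasDerivAt χ (deriv χ t) t :=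
  ((h.smooth_χ.differentiable two_ne_zero) t).hasDerivAt

lemma contDiff_deriv_β (h : ShearProfile β χ A κ C) : ContDiff ℝ 1 (deriv β) :=
  h.smooth_β.deriv'

lemma contDiff_deriv_χ (h : ShearProfile β χ A κ C) : ContDiff ℝ 1 (deriv χ) :=
  h.smooth_χ.deriv'

end ShearProfile

/-- The Piola pull-back of a test matrix under the shear. -/
def pull (β χ : ℝ → ℝ) (p : Fin 2 → Fin 2 → Plane → ℝ) (i j : Fin 2) (z : Plane) : ℝ :=
  if j = 0 then p i 0 (shear β χ z) - deriv χ (z 1) * β (z 0) * p i 1 (shear β χ z)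
  else (1 + χ (z 1) * deriv β (z 0)) * p i 1 (shear β χ z)

namespace ShearProfile

variable {β χ : ℝ → ℝ} {A κ C : ℝ}

lemma contDiff_shear (h : ShearProfile β χ A κ C) : ContDiff ℝ 1 (shear β χ) := by
  have hβ := h.smooth_β.of_le one_le_two
  have hχ := h.smooth_χ.of_le one_le_two
  refine contDiff_euclidean.2 fun i => ?_
  fin_cases i
  · show ContDiff ℝ 1 fun z : Plane => z 0 + χ (z 1) * β (z 0)
    fun_prop
  · show ContDiff ℝ 1 fun z : Plane => z 1
    fun_prop

lemma isTest_pull (h : ShearProfile β χ A κ C) {p : Fin 2 → Fin 2 → Plane → ℝ}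
    (hp : IsTest unitSq p) : IsTest unitSq (pull β χ p) := by
  refine ⟨fun i j => ?_, ?_⟩
  · have hβ := h.smooth_β.of_le one_le_two
    have hχ := h.smooth_χ.of_le one_le_two
    have hβ' := h.contDiff_deriv_β
    have hχ' := h.contDiff_deriv_χ
    have h0 := (hp.smooth i 0).comp h.contDiff_shear
    have h1 := (hp.smooth i 1).comp h.contDiff_shear
    have c0 : ContDiff ℝ 1 fun z : Plane => z 0 := by fun_prop
    have c1 : ContDiff ℝ 1 fun z : Plane => z 1 := by fun_prop
    fin_cases j
    · show ContDiff ℝ 1 fun z : Plane =>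
        p i 0 (shear β χ z) - deriv χ (z 1) * β (z 0) * p i 1 (shear β χ z)
      exact h0.sub (((hχ'.comp c1).mul (hβ.comp c0)).mul h1)
    · show ContDiff ℝ 1 fun z : Plane => (1 + χ (z 1) * deriv β (z 0)) * p i 1 (shear β χ z)
      exact (contDiff_const.add ((hχ.comp c1).mul (hβ'.comp c0))).mul h1
  · obtain ⟨K, hK, hKU, hz⟩ := hp.supp
    refine ⟨h.homeo ⁻¹' K, h.homeo.isCompact_preimage.2 hK, ?_, ?_⟩
    · intro z hz
      exact (h.shear_mem_iff z).1 (hKU hz)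
    · intro i j x hx
      have hx' : shear β χ x ∉ K := hx
      simp [pull, hz _ _ _ hx']

lemma hasDerivAt_shear_zero (h : ShearProfile β χ A κ C) (z : Plane) :
    HasDerivAt (fun t : ℝ => shear β χ (z + t • e2 0))
      ((1 + χ (z 1) * deriv β (z 0)) • e2 0 + (0 : ℝ) • e2 1) 0 := by
  have e : (fun t : ℝ => shear β χ (z + t • e2 0)) =
      fun t => (z 0 + t + χ (z 1) * β (z 0 + t)) • e2 0 + (z 1) • e2 1 := by
    ext t i
    fin_cases i <;> simp [shear, e2]
  rw [e]
  have hb : HasDerivAt (fun t : ℝ => β (z 0 + t)) (deriv β (z 0)) 0 := by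
    have := h.hasDerivAt_β (z 0 + 0)
    rw [add_zero] at this
    exact (HasDerivAt.comp_const_add (z 0) 0 (by simpa using this))
  exact (((hasDerivAt_id (0:ℝ)).const_add (z 0)).add (hb.const_mul _) |>.smul_const (e2 0)).add
    ((hasDerivAt_const (0:ℝ) (z 1)).smul_const (e2 1))

lemma hasDerivAt_shear_one (h : ShearProfile β χ A κ C) (z : Plane) :
    HasDerivAt (fun t : ℝ => shear β χ (z + t • e2 1))
      ((deriv χ (z 1) * β (z 0)) • e2 0 + (1 : ℝ) • e2 1) 0 := by
  have e : (fun t : ℝ => shear β χ (z + t • e2 1)) =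
      fun t => (z 0 + χ (z 1 + t) * β (z 0)) • e2 0 + (z 1 + t) • e2 1 := by
    ext t i
    fin_cases i <;> simp [shear, e2]
  rw [e]
  have hb : HasDerivAt (fun t : ℝ => χ (z 1 + t)) (deriv χ (z 1)) 0 := by
    have := h.hasDerivAt_χ (z 1 + 0)
    rw [add_zero] at this
    exact (HasDerivAt.comp_const_add (z 1) 0 (by simpa using this))
  exact (((hb.mul_const _).const_add (z 0)).smul_const (e2 0)).add
    (((hasDerivAt_id (0:ℝ)).const_add (z 1)).smul_const (e2 1))

lemma rowDiv_pull (h : ShearProfile β χ A κ C) {p : Fin 2 → Fin 2 → Plane → ℝ}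
    (hp : IsTest unitSq p) (i : Fin 2) (z : Plane) :
    rowDiv (pull β χ p) i z =
      (1 + χ (z 1) * deriv β (z 0)) * rowDiv p i (shear β χ z) := by
  have hq := h.isTest_pull hp
  have hd : ∀ j, HasFDerivAt (p i j) (fderiv ℝ (p i j) (shear β χ z)) (shear β χ z) := fun j =>
    ((hp.smooth i j).differentiable one_ne_zero _).hasFDerivAt
  have c0 : ∀ j, HasDerivAt (fun t : ℝ => p i j (shear β χ (z + t • e2 0)))
      ((1 + χ (z 1) * deriv β (z 0)) * pd 0 (p i j) (shear β χ z)) 0 := by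
    intro j
    have := HasFDerivAt.comp_hasDerivAt (x := (0:ℝ)) (f := fun t : ℝ => shear β χ (z + t • e2 0))
      (l := p i j) (l' := fderiv ℝ (p i j) (shear β χ z)) (by simpa using hd j)
      (h.hasDerivAt_shear_zero z)
    rw [fderiv_apply_eq, zero_mul, add_zero] at this
    exact this
  have c1 : ∀ j, HasDerivAt (fun t : ℝ => p i j (shear β χ (z + t • e2 1)))
      (deriv χ (z 1) * β (z 0) * pd 0 (p i j) (shear β χ z) + pd 1 (p i j) (shear β χ z)) 0 := by
    intro j
    have := HasFDerivAt.comp_hasDerivAt (x := (0:ℝ)) (f := fun t : ℝ => shear β χ (z + t • e2 1))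
      (l := p i j) (l' := fderiv ℝ (p i j) (shear β χ z)) (by simpa using hd j)
      (h.hasDerivAt_shear_one z)
    rw [fderiv_apply_eq, one_mul] at this
    exact this
  have hb : HasDerivAt (fun t : ℝ => β (z 0 + t)) (deriv β (z 0)) 0 := by
    have := h.hasDerivAt_β (z 0 + 0)
    rw [add_zero] at this
    exact (HasDerivAt.comp_const_add (z 0) 0 (by simpa using this))
  have hχ : HasDerivAt (fun t : ℝ => χ (z 1 + t)) (deriv χ (z 1)) 0 := by
    have := h.hasDerivAt_χ (z 1 + 0)
    rw [add_zero] at this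
    exact (HasDerivAt.comp_const_add (z 1) 0 (by simpa using this))
  have p0 : pd 0 (pull β χ p i 0) z = (1 + χ (z 1) * deriv β (z 0)) * pd 0 (p i 0) (shear β χ z)
      - (deriv χ (z 1) * deriv β (z 0) * p i 1 (shear β χ z) + deriv χ (z 1) * β (z 0) *
        ((1 + χ (z 1) * deriv β (z 0)) * pd 0 (p i 1) (shear β χ z))) := by
    refine pd_eq_of_hasDerivAt ((hq.smooth i 0).differentiable one_ne_zero z) ?_
    have := (c0 0).sub ((hb.const_mul (deriv χ (z 1))).mul (c0 1))
    simp only [zero_smul, add_zero] at this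
    refine this.congr_of_eventuallyEq (Filter.Eventually.of_forall fun t => ?_)
    simp [pull, e2]
  have p1 : pd 1 (pull β χ p i 1) z = deriv χ (z 1) * deriv β (z 0) * p i 1 (shear β χ z)
      + (1 + χ (z 1) * deriv β (z 0)) *
        (deriv χ (z 1) * β (z 0) * pd 0 (p i 1) (shear β χ z) + pd 1 (p i 1) (shear β χ z)) := by
    refine pd_eq_of_hasDerivAt ((hq.smooth i 1).differentiable one_ne_zero z) ?_
    have := ((hχ.mul_const (deriv β (z 0))).const_add 1).mul (c1 1)
    simp only [zero_smul, add_zero] at this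
    refine this.congr_of_eventuallyEq (Filter.Eventually.of_forall fun t => ?_)
    simp [pull, e2]
  rw [rowDiv, p0, p1, rowDiv]
  ring

lemma det_fderiv_shear (h : ShearProfile β χ A κ C) (z : Plane) :
    (fderiv ℝ (shear β χ) z).det = 1 + χ (z 1) * deriv β (z 0) := by
  have hd : HasFDerivAt (shear β χ) (fderiv ℝ (shear β χ) z) z :=
    (h.contDiff_shear.differentiable one_ne_zero z).hasFDerivAt
  have h0 := (hd.hasLineDerivAt (e2 0)).unique (h.hasDerivAt_shear_zero z)
  have h1 := (hd.hasLineDerivAt (e2 1)).unique (h.hasDerivAt_shear_one z)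
  rw [ContinuousLinearMap.det, ← LinearMap.det_toMatrix (EuclideanSpace.basisFun (Fin 2) ℝ).toBasis,
    Matrix.det_fin_two]
  simp only [e2] at h0 h1
  simp [LinearMap.toMatrix_apply, h0, h1]

lemma one_add_nonneg (h : ShearProfile β χ A κ C) (z : Plane) :
    0 ≤ 1 + χ (z 1) * deriv β (z 0) := by
  have h1 := abs_le.1 (h.abs_deriv_β (z 0))
  have h2 := h.χ_nonneg (z 1)
  have h3 := h.χ_le (z 1)
  have h4 := h.κ_lt_one
  nlinarith [h.κ_nonneg]

lemma pairing_comp_symm (h : ShearProfile β χ A κ C) (f : Plane → Plane)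
    {p : Fin 2 → Fin 2 → Plane → ℝ} (hp : IsTest unitSq p) :
    pairing (f ∘ h.homeo.symm) p unitSq = pairing f (pull β χ p) unitSq := by
  have key := integral_image_eq_integral_abs_det_fderiv_smul volume isOpen_unitSq.measurableSet
    (fun z _ => ((h.contDiff_shear.differentiable one_ne_zero z).hasFDerivAt).hasFDerivWithinAt)
    h.homeo.injective.injOn (pairingFun (f ∘ h.homeo.symm) p)
  rw [h.image_unitSq] at key
  rw [pairing, key, pairing]
  congr 1
  ext z
  have e : h.homeo.symm (shear β χ z) = z := h.homeo.symm_apply_apply z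
  rw [h.det_fderiv_shear, abs_of_nonneg (h.one_add_nonneg z)]
  simp only [pairingFun, Function.comp, e, h.rowDiv_pull hp, smul_eq_mul]
  ring

/-- The variations of the two compositions with opposite shears are controlled on average. -/
lemma pairing_add_pairing_le (h : ShearProfile β χ A κ C) {f : Plane → Plane}
    (hf : IsBV f unitSq) {p q : Fin 2 → Fin 2 → Plane → ℝ} (hp : IsTest unitSq p)
    (hq : IsTest unitSq q) (hpb : ∀ i j x, |p i j x| ≤ 1) (hqb : ∀ i j x, |q i j x| ≤ 1) :
    pairing (f ∘ h.homeo.symm) p unitSq + pairing (f ∘ h.neg.homeo.symm) q unitSq ≤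
      2 * (1 + C * A) * Var f unitSq := by
  rw [h.pairing_comp_symm f hp, h.neg.pairing_comp_symm f hq]
  have hp' := h.isTest_pull hp
  have hq' := h.neg.isTest_pull hq
  set P := pull β χ p with hP
  set R := pull (fun t => -β t) χ q with hR
  have hCA : 0 ≤ C * A := mul_nonneg h.C_nonneg h.A_nonneg
  set c : ℝ := 2 * (1 + C * A) with hc
  have hc0 : 0 < c := by positivity
  have ht : IsTest unitSq fun i j x => c⁻¹ * (P i j x + R i j x) := by
    obtain ⟨K, hK, hKU, hKz⟩ := hp'.supp
    obtain ⟨L, hL, hLU, hLz⟩ := hq'.supp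
    refine ⟨fun i j => contDiff_const.mul ((hp'.smooth i j).add (hq'.smooth i j)), K ∪ L,
      hK.union hL, union_subset hKU hLU, ?_⟩
    intro i j x hx
    rw [mem_union, not_or] at hx
    simp [hKz _ _ _ hx.1, hLz _ _ _ hx.2]
  have hdn : deriv (fun t => -β t) = fun t => -deriv β t := by
    rw [show (fun t => -β t) = -β from rfl, deriv.neg']
  have hb : ∀ i j x, |c⁻¹ * (P i j x + R i j x)| ≤ 1 := by
    intro i j x
    rw [abs_mul, abs_of_pos (inv_pos.2 hc0), inv_mul_le_iff₀ hc0, mul_one]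
    have hχβ : |deriv χ (x 1) * β (x 0)| ≤ C * A := by
      rw [abs_mul]
      exact mul_le_mul (h.abs_deriv_χ _) (h.abs_β _) (abs_nonneg _) h.C_nonneg
    have hj : j = 0 ∨ j = 1 := by omega
    rcases hj with rfl | rfl
    · have b1 : |P i 0 x| ≤ 1 + C * A := by
        simp only [hP, pull, if_true]
        refine (abs_sub _ _).trans (add_le_add (hpb _ _ _) ?_)
        rw [abs_mul]
        exact (mul_le_mul hχβ (hpb _ _ _) (abs_nonneg _) hCA).trans (mul_one _).le
      have b2 : |R i 0 x| ≤ 1 + C * A := by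
        simp only [hR, pull, if_true]
        refine (abs_sub _ _).trans (add_le_add (hqb _ _ _) ?_)
        rw [abs_mul, mul_neg, abs_neg]
        exact (mul_le_mul hχβ (hqb _ _ _) (abs_nonneg _) hCA).trans (mul_one _).le
      exact (abs_add_le _ _).trans (by rw [hc]; linarith)
    · have b1 : |P i 1 x| ≤ 1 + χ (x 1) * deriv β (x 0) := by
        simp only [hP, pull, one_ne_zero, if_false]
        rw [abs_mul, abs_of_nonneg (h.one_add_nonneg x)]
        exact mul_le_of_le_one_right (h.one_add_nonneg x) (hpb _ _ _)
      have b2 : |R i 1 x| ≤ 1 - χ (x 1) * deriv β (x 0) := by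
        have := h.neg.one_add_nonneg x
        simp only [hR, pull, one_ne_zero, if_false]
        rw [abs_mul, abs_of_nonneg this]
        refine (mul_le_of_le_one_right this (hqb _ _ _)).trans (le_of_eq ?_)
        rw [hdn]; ring
      exact (abs_add_le _ _).trans (by rw [hc]; linarith)
  have hle := le_csSup hf.2 ((mem_varSet_iff f unitSq _).2 ⟨_, ht, hb, rfl⟩)
  have hlin : pairing f (fun i j x => c⁻¹ * (P i j x + R i j x)) unitSq =
      c⁻¹ * (pairing f P unitSq + pairing f R unitSq) := by
    rw [pairing, pairing, pairing, ← integral_add (integrableOn_pairingFun hf.1 hp')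
      (integrableOn_pairingFun hf.1 hq'), ← integral_const_mul]
    congr 1
    ext x
    have hpd : ∀ k i j, pd k (fun x => c⁻¹ * (P i j x + R i j x)) x =
        c⁻¹ * (pd k (P i j) x + pd k (R i j) x) := by
      intro k i j
      have d1 := (hp'.smooth i j).differentiable one_ne_zero x
      have d2 := (hq'.smooth i j).differentiable one_ne_zero x
      rw [pd, fderiv_const_mul (d1.fun_add d2), fderiv_fun_add d1 d2]
      rfl
    simp only [pairingFun, rowDiv, hpd]
    ring
  rw [hlin, inv_mul_le_iff₀ hc0] at hle
  exact hle

lemma bddAbove_varSet (h : ShearProfile β χ A κ C) {f : Plane → Plane} (hf : IsBV f unitSq) :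
    BddAbove (varSet (f ∘ h.homeo.symm) unitSq) := by
  refine ⟨2 * (1 + C * A) * Var f unitSq, ?_⟩
  intro v hv
  obtain ⟨p, hp, hb, rfl⟩ := (mem_varSet_iff _ _ _).1 hv
  obtain ⟨q, hq, hqb, h0⟩ := (mem_varSet_iff _ _ _).1
    (zero_mem_varSet (f ∘ h.neg.homeo.symm) unitSq)
  have := h.pairing_add_pairing_le hf hp hq hb hqb
  rwa [← h0, add_zero] at this

lemma Var_add_Var_le (h : ShearProfile β χ A κ C) {f : Plane → Plane} (hf : IsBV f unitSq) :
    Var (f ∘ h.homeo.symm) unitSq + Var (f ∘ h.neg.homeo.symm) unitSq ≤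
      2 * (1 + C * A) * Var f unitSq := by
  rw [← le_sub_iff_add_le]
  refine csSup_le ⟨0, zero_mem_varSet _ _⟩ fun v hv => ?_
  rw [le_sub_comm]
  refine csSup_le ⟨0, zero_mem_varSet _ _⟩ fun w hw => ?_
  obtain ⟨p, hp, hb, rfl⟩ := (mem_varSet_iff _ _ _).1 hv
  obtain ⟨q, hq, hqb, rfl⟩ := (mem_varSet_iff _ _ _).1 hw
  linarith [h.pairing_add_pairing_le hf hp hq hb hqb]

end ShearProfile

/-- A smooth function supported in `[a + ρ, b - ρ]` and equal to `1` on `[a + 2ρ, b - 2ρ]`. -/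
def bump (a b ρ y : ℝ) : ℝ :=
  Real.smoothTransition ((y - a) / ρ - 1) * Real.smoothTransition ((b - y) / ρ - 1)

lemma bump_nonneg (a b ρ y : ℝ) : 0 ≤ bump a b ρ y :=
  mul_nonneg (Real.smoothTransition.nonneg _) (Real.smoothTransition.nonneg _)

lemma bump_le_one (a b ρ y : ℝ) : bump a b ρ y ≤ 1 :=
  mul_le_one₀ (Real.smoothTransition.le_one _) (Real.smoothTransition.nonneg _)
    (Real.smoothTransition.le_one _)

lemma contDiff_bump (a b ρ : ℝ) (n : ℕ) : ContDiff ℝ n (bump a b ρ) := by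
  have h : ContDiff ℝ n Real.smoothTransition := Real.smoothTransition.contDiff (n := (n : ℕ∞))
  unfold bump
  exact (h.comp (by fun_prop)).mul (h.comp (by fun_prop))

lemma bump_eq_zero {a b ρ y : ℝ} (hρ : 0 < ρ) (hy : y ∉ Icc (a + ρ) (b - ρ)) :
    bump a b ρ y = 0 := by
  rw [mem_Icc, not_and_or, not_le, not_le] at hy
  rcases hy with hy | hy
  · have : (y - a) / ρ - 1 ≤ 0 := by
      rw [sub_nonpos, div_le_one hρ]; linarith
    rw [bump, Real.smoothTransition.zero_of_nonpos this, zero_mul]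
  · have : (b - y) / ρ - 1 ≤ 0 := by
      rw [sub_nonpos, div_le_one hρ]; linarith
    rw [bump, Real.smoothTransition.zero_of_nonpos this, mul_zero]

lemma bump_eq_one {a b ρ y : ℝ} (hρ : 0 < ρ) (hy : y ∈ Icc (a + 2 * ρ) (b - 2 * ρ)) :
    bump a b ρ y = 1 := by
  have h1 : 1 ≤ (y - a) / ρ - 1 := by
    rw [le_sub_iff_add_le, le_div_iff₀ hρ]; linarith [hy.1]
  have h2 : 1 ≤ (b - y) / ρ - 1 := by
    rw [le_sub_iff_add_le, le_div_iff₀ hρ]; linarith [hy.2]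
  rw [bump, Real.smoothTransition.one_of_one_le h1, Real.smoothTransition.one_of_one_le h2, one_mul]

lemma exists_abs_deriv_bump_le (a b : ℝ) {ρ : ℝ} (hρ : 0 < ρ) :
    ∃ C, ∀ y, |deriv (bump a b ρ) y| ≤ C := by
  have hc : HasCompactSupport (bump a b ρ) :=
    HasCompactSupport.intro isCompact_Icc fun y hy => bump_eq_zero hρ hy
  exact hc.deriv.exists_bound_of_continuous
    ((contDiff_bump a b ρ 1).continuous_deriv (by norm_num))

/-- A periodic perturbation whose derivative is close to a square wave when `κ` is close
to `1`. -/
def wave (κ : ℝ) (k : ℕ) (t : ℝ) : ℝ :=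
  (Real.arcsin κ - Real.arcsin (κ * Real.cos (2 * Real.pi * k * t))) / (2 * Real.pi * k)

section wave

variable {κ : ℝ} (h0 : 0 ≤ κ) (h1 : κ < 1) {k : ℕ} (hk : 1 ≤ k)

include h0 h1

lemma abs_mul_cos_lt (θ : ℝ) : |κ * Real.cos θ| < 1 := by
  rw [abs_mul, abs_of_nonneg h0]
  exact (mul_le_of_le_one_right h0 (Real.abs_cos_le_one θ)).trans_lt h1

lemma contDiff_wave (k : ℕ) : ContDiff ℝ 2 (wave κ k) := by
  unfold wave
  refine ContDiff.div_const (contDiff_const.sub ?_) _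
  rw [contDiff_iff_contDiffAt]
  intro t
  have h := abs_lt.1 (abs_mul_cos_lt h0 h1 (2 * Real.pi * k * t))
  have hc : ContDiffAt ℝ 2 (fun t : ℝ => κ * Real.cos (2 * Real.pi * k * t)) t := by fun_prop
  exact ContDiffAt.comp (g := Real.arcsin) t (Real.contDiffAt_arcsin h.1.ne' h.2.ne) hc

include hk

lemma abs_deriv_wave_le (t : ℝ) : |deriv (wave κ k) t| ≤ κ := by
  have hk0 : (0:ℝ) < k := by exact_mod_cast hk
  have hpi := Real.pi_pos
  set c : ℝ := 2 * Real.pi * k with hc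
  have hc0 : 0 < c := by positivity
  have h := abs_lt.1 (abs_mul_cos_lt h0 h1 (c * t))
  have hd : HasDerivAt (wave κ k)
      (-(1 / √(1 - (κ * Real.cos (c * t)) ^ 2) * (κ * (-Real.sin (c * t) * (c * 1)))) / c) t := by
    have d1 : HasDerivAt (fun t => κ * Real.cos (c * t)) (κ * (-Real.sin (c * t) * (c * 1))) t :=
      (((hasDerivAt_id t).const_mul c).cos).const_mul κ
    have d2 := (Real.hasDerivAt_arcsin h.1.ne' h.2.ne).comp t d1
    exact (d2.const_sub _).div_const c
  rw [hd.deriv]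
  set s := √(1 - (κ * Real.cos (c * t)) ^ 2) with hs
  have hpos : 0 < 1 - (κ * Real.cos (c * t)) ^ 2 := by
    have := (sq_lt_one_iff_abs_lt_one _).2 (abs_mul_cos_lt h0 h1 (c * t))
    linarith
  have hs0 : 0 < s := Real.sqrt_pos.2 hpos
  have e : -(1 / s * (κ * (-Real.sin (c * t) * (c * 1)))) / c = κ * (Real.sin (c * t) / s) := by
    field_simp
  rw [e, abs_mul, abs_of_nonneg h0]
  refine mul_le_of_le_one_right h0 ?_
  rw [abs_div, abs_of_pos hs0, div_le_one hs0, hs]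
  refine Real.le_sqrt_of_sq_le ?_
  rw [sq_abs]
  have := Real.sin_sq_add_cos_sq (c * t)
  have h2 : κ ^ 2 ≤ 1 := by nlinarith
  nlinarith [sq_nonneg (Real.cos (c * t))]

omit h0 h1 in
lemma abs_wave_le (t : ℝ) : |wave κ k t| ≤ 1 / (2 * k) := by
  have hk0 : (0:ℝ) < k := by exact_mod_cast hk
  have hpi := Real.pi_pos
  rw [wave, abs_div, abs_of_pos (show (0:ℝ) < 2 * Real.pi * k by positivity),
    div_le_div_iff₀ (by positivity) (by positivity)]
  have : |Real.arcsin κ - Real.arcsin (κ * Real.cos (2 * Real.pi * k * t))| ≤ Real.pi := by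
    rw [abs_le]
    constructor <;> linarith [Real.arcsin_le_pi_div_two κ, Real.neg_pi_div_two_le_arcsin κ,
      Real.arcsin_le_pi_div_two (κ * Real.cos (2 * Real.pi * k * t)),
      Real.neg_pi_div_two_le_arcsin (κ * Real.cos (2 * Real.pi * k * t))]
  nlinarith

omit h0 h1 in
lemma wave_even (i : ℕ) : wave κ k (2 * i / (2 * k)) = 0 := by
  have hk0 : (k:ℝ) ≠ 0 := by positivity
  have : 2 * Real.pi * k * (2 * i / (2 * k)) = i * (2 * Real.pi) := by field_simp
  rw [wave, this, Real.cos_nat_mul_two_pi, mul_one, sub_self, zero_div]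

omit h0 h1 in
lemma wave_odd (i : ℕ) : wave κ k ((2 * i + 1) / (2 * k)) = Real.arcsin κ / (Real.pi * k) := by
  have hk0 : (k:ℝ) ≠ 0 := by positivity
  have : 2 * Real.pi * k * ((2 * i + 1) / (2 * k)) = i * (2 * Real.pi) + Real.pi := by
    field_simp
  rw [wave, this, Real.cos_add_pi, Real.cos_nat_mul_two_pi, mul_neg_one, Real.arcsin_neg]
  field_simp
  ring

end wave

lemma shearProfile_wave {κ : ℝ} (h0 : 0 ≤ κ) (h1 : κ < 1) {k : ℕ} (hk : 1 ≤ k) {ρ C : ℝ}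
    (hρ : 0 < ρ) (hC : ∀ y, |deriv (bump 0 1 ρ) y| ≤ C) (hlt : κ + C * (1 / (2 * k)) < 1) :
    ShearProfile (wave κ k) (bump 0 1 ρ) (1 / (2 * k)) κ C where
  smooth_β := contDiff_wave h0 h1 k
  smooth_χ := contDiff_bump 0 1 ρ 2
  abs_β := abs_wave_le hk
  abs_deriv_β := abs_deriv_wave_le h0 h1 hk
  χ_nonneg := bump_nonneg 0 1 ρ
  χ_le := bump_le_one 0 1 ρ
  abs_deriv_χ := hC
  lt_one := hlt
  β_zero := by simpa using wave_even (κ := κ) hk 0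
  β_one := by
    have h := wave_even (κ := κ) hk k
    rwa [div_self] at h
    positivity
  χ_zero := bump_eq_zero hρ fun h => by linarith [h.1]
  χ_one := bump_eq_zero hρ fun h => by linarith [h.2]

namespace ShearProfile

variable {β χ : ℝ → ℝ} {A κ C : ℝ}

/-- Precomposition of a homeomorphism of the square (paired with its inverse) by the inverse
of a shear. -/
def precomp (h : ShearProfile β χ A κ C) (p : (Plane → Plane) × (Plane → Plane)) :
    (Plane → Plane) × (Plane → Plane) :=
  (p.1 ∘ h.homeo.symm, shear β χ ∘ p.2)

lemma isHomeoOn_precomp (h : ShearProfile β χ A κ C) {p : (Plane → Plane) × (Plane → Plane)}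
    (hp : IsHomeoOn p.1 p.2 unitSq unitSq) :
    IsHomeoOn (h.precomp p).1 (h.precomp p).2 unitSq unitSq := by
  obtain ⟨hb, hc, hi, hci⟩ := hp
  have hm : MapsTo h.homeo.symm unitSq unitSq := fun z hz => (h.symm_mem_iff z).2 hz
  have hm2 : MapsTo p.2 unitSq unitSq := hi.1.mapsTo hb.surjOn
  refine ⟨hb.comp ⟨hm, h.homeo.symm.injective.injOn, ?_⟩,
    hc.comp h.homeo.symm.continuous.continuousOn hm, ⟨?_, ?_⟩,
    h.contDiff_shear.continuous.comp_continuousOn hci⟩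
  · intro z hz
    exact ⟨h.homeo z, (h.shear_mem_iff z).2 hz, h.homeo.symm_apply_apply z⟩
  · intro z hz
    simp only [precomp, Function.comp, hi.1 (hm hz)]
    exact h.homeo.apply_symm_apply z
  · intro z hz
    have e : h.homeo.symm (shear β χ (p.2 z)) = p.2 z := h.homeo.symm_apply_apply _
    simp only [precomp, Function.comp, e, hi.2 hz]

lemma extendsToId_precomp (h : ShearProfile β χ A κ C) {f : Plane → Plane}
    (hf : ExtendsToId f) : ExtendsToId (f ∘ h.homeo.symm) := by
  refine ⟨hf.1.comp h.homeo.symm.continuous.continuousOn fun z hz => h.symm_mem_closure hz, ?_⟩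
  intro z hz
  simp only [Function.comp, h.symm_frontier hz]
  exact hf.2 hz

end ShearProfile

lemma volume_unitSq_lt_top : volume unitSq < ⊤ :=
  (measure_mono subset_closure).trans_lt isCompact_closure_unitSq.measure_lt_top

lemma IsHomeoOn.integrableOn {f g : Plane → Plane} (h : IsHomeoOn f g unitSq unitSq) :
    IntegrableOn f unitSq := by
  obtain ⟨C, hC⟩ := isCompact_closure_unitSq.isBounded.exists_norm_le
  refine IntegrableOn.of_bound volume_unitSq_lt_top
    (h.2.1.aestronglyMeasurable isOpen_unitSq.measurableSet) C ?_
  filter_upwards [ae_restrict_mem isOpen_unitSq.measurableSet] with x hx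
  exact hC _ (subset_closure (h.1.mapsTo hx))

lemma ShearProfile.isBV_precomp {β χ : ℝ → ℝ} {A κ C : ℝ} (h : ShearProfile β χ A κ C)
    {p : (Plane → Plane) × (Plane → Plane)} (hp : IsHomeoOn p.1 p.2 unitSq unitSq)
    (hf : IsBV p.1 unitSq) : IsBV (p.1 ∘ h.homeo.symm) unitSq :=
  ⟨(h.isHomeoOn_precomp hp).integrableOn, h.bddAbove_varSet hf⟩

/-- Small shears move elements of `X` by a small amount, including their variation. -/
lemma exists_forall_precomp_dX_lt {M : ℝ} {p : (Plane → Plane) × (Plane → Plane)} (hp : p ∈ X M)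
    {ε : ℝ} (hε : 0 < ε) {C : ℝ} (hC : 0 ≤ C) :
    ∃ a > 0, ∀ (β χ : ℝ → ℝ) (A κ : ℝ) (h : ShearProfile β χ A κ C), A ≤ a →
      h.precomp p ∈ X M ∧ dX M p (h.precomp p) < ε := by
  obtain ⟨hhom, hext, hBV, hVM⟩ := hp
  set V := Var p.1 unitSq with hV
  have hV0 : 0 ≤ V := le_csSup hBV.2 (zero_mem_varSet p.1 unitSq)
  obtain ⟨η, hη, hηV⟩ : ∃ η > 0, ∀ v, dist v V < η →
      v < M ∧ |1 / (M - V) - 1 / (M - v)| < ε / 3 := by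
    have hcont : ContinuousAt (fun v => 1 / (M - v)) V :=
      ContinuousAt.div continuousAt_const (by fun_prop) (by linarith)
    obtain ⟨η, hη, h1⟩ := Metric.continuousAt_iff.1 hcont (ε / 3) (by linarith)
    refine ⟨min η (M - V), lt_min hη (by linarith), fun v hv => ⟨?_, ?_⟩⟩
    · have := (le_abs_self (v - V)).trans_lt (hv.trans_le (min_le_right _ _))
      linarith
    · have := h1 (hv.trans_le (min_le_left _ _))
      rwa [dist_comm, Real.dist_eq] at this
  obtain ⟨δ₁, hδ₁, hlsc⟩ := exists_forall_dist_lt_Var hBV.1 (show V - η / 2 < Var p.1 unitSq by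
    linarith)
  obtain ⟨δ₂, hδ₂, huc⟩ := Metric.uniformContinuousOn_iff.1
    (isCompact_closure_unitSq.uniformContinuousOn_of_continuous hext.1) (min δ₁ (ε / 4))
    (lt_min hδ₁ (by linarith))
  have hCV : 0 ≤ C * V := mul_nonneg hC hV0
  refine ⟨min (δ₂ / 2) (min (ε / 4) (η / (8 * (1 + C * V)))),
    lt_min (by linarith) (lt_min (by linarith) (by positivity)), ?_⟩
  intro β χ A κ h hA
  obtain ⟨hA1, hA2, hA3⟩ : A ≤ δ₂ / 2 ∧ A ≤ ε / 4 ∧ A ≤ η / (8 * (1 + C * V)) :=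
    ⟨hA.trans (min_le_left _ _), hA.trans ((min_le_right _ _).trans (min_le_left _ _)),
      hA.trans ((min_le_right _ _).trans (min_le_right _ _))⟩
  have hclose : ∀ {β : ℝ → ℝ} (h : ShearProfile β χ A κ C), ∀ x ∈ unitSq,
      dist (p.1 x) ((p.1 ∘ h.homeo.symm) x) < min δ₁ (ε / 4) := by
    intro β h x hx
    exact huc x (subset_closure hx) _ (subset_closure ((h.symm_mem_iff x).2 hx))
      ((h.dist_symm_le x).trans_lt (by linarith))
  have hlow : ∀ {β : ℝ → ℝ} (h : ShearProfile β χ A κ C),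
      V - η / 2 < Var (p.1 ∘ h.homeo.symm) unitSq := by
    intro β h
    have hb := h.isBV_precomp hhom hBV
    exact hlsc _ hb.1 hb.2 fun x hx => (hclose h x hx).trans_le (min_le_left _ _)
  have hup : Var (p.1 ∘ h.homeo.symm) unitSq < V + η := by
    have h1 := h.Var_add_Var_le hBV
    have h2 := hlow h.neg
    have h3 : A * (8 * (1 + C * V)) ≤ η := by rwa [le_div_iff₀ (by positivity)] at hA3
    have := h.A_nonneg
    nlinarith
  have hd : dist (Var (p.1 ∘ h.homeo.symm) unitSq) V < η := by
    rw [Real.dist_eq, abs_lt]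
    constructor <;> linarith [hlow h]
  obtain ⟨hM', hinv⟩ := hηV _ hd
  refine ⟨⟨h.isHomeoOn_precomp hhom, h.extendsToId_precomp hext, h.isBV_precomp hhom hBV, hM'⟩, ?_⟩
  have s1 : supDist p.1 (h.precomp p).1 unitSq ≤ ε / 4 :=
    supDist_le (by linarith) fun x hx => ((hclose h x hx).trans_le (min_le_right _ _)).le
  have s2 : supDist p.2 (h.precomp p).2 unitSq ≤ ε / 4 :=
    supDist_le (by linarith) fun x _ => by
      rw [dist_comm]
      exact (h.dist_shear_le _).trans hA2
  show supDist p.1 (h.precomp p).1 unitSq + supDist p.2 (h.precomp p).2 unitSq +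
    |1 / (M - V) - 1 / (M - Var (p.1 ∘ h.homeo.symm) unitSq)| < ε
  linarith

/-- The plane as a product of two lines. -/
def planeEquiv : Plane ≃ᵐ ℝ × ℝ :=
  (MeasurableEquiv.toLp 2 (Fin 2 → ℝ)).symm.trans MeasurableEquiv.finTwoArrow

lemma measurePreserving_planeEquiv : MeasurePreserving planeEquiv :=
  (volume_preserving_finTwoArrow ℝ).comp
    (EuclideanSpace.volume_preserving_symm_measurableEquiv_toLp (Fin 2))

lemma integral_plane {F : ℝ → ℝ → ℝ} (hF : Integrable fun z : Plane => F (z 0) (z 1)) :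
    ∫ z : Plane, F (z 0) (z 1) = ∫ y, ∫ x, F x y := by
  have h1 : Integrable (fun q : ℝ × ℝ => F q.1 q.2) := by
    rw [← measurePreserving_planeEquiv.integrable_comp_emb planeEquiv.measurableEmbedding]
    exact hF
  have h2 := measurePreserving_planeEquiv.integral_comp planeEquiv.measurableEmbedding
    (fun q : ℝ × ℝ => F q.1 q.2)
  rw [← integral_prod_symm _ h1]
  exact h2

lemma continuous_deriv_smoothTransition : Continuous (deriv Real.smoothTransition) :=
  (Real.smoothTransition.contDiff (n := 1)).continuous_deriv le_rfl

lemma deriv_smoothTransition_eq_zero {v : ℝ} (hv : v ∉ Icc (0 : ℝ) 1) :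
    deriv Real.smoothTransition v = 0 := by
  rw [mem_Icc, not_and_or, not_le, not_le] at hv
  rcases hv with hv | hv
  · have : Real.smoothTransition =ᶠ[nhds v] fun _ => (0 : ℝ) := by
      filter_upwards [Iio_mem_nhds hv] with x hx
      exact Real.smoothTransition.zero_of_nonpos (le_of_lt hx)
    rw [this.deriv_eq, deriv_const]
  · have : Real.smoothTransition =ᶠ[nhds v] fun _ => (1 : ℝ) := by
      filter_upwards [Ioi_mem_nhds hv] with x hx
      exact Real.smoothTransition.one_of_one_le (le_of_lt hx)
    rw [this.deriv_eq, deriv_const]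

lemma integral_deriv_smoothTransition : ∫ v in (0 : ℝ)..1, deriv Real.smoothTransition v = 1 := by
  rw [intervalIntegral.integral_deriv_eq_sub
    (fun x _ => (Real.smoothTransition.contDiff (n := 1)).differentiable (by simp) x)
    (continuous_deriv_smoothTransition.intervalIntegrable _ _),
    Real.smoothTransition.one_of_one_le le_rfl, Real.smoothTransition.zero_of_nonpos le_rfl,
    sub_zero]

lemma hasDerivAt_smoothTransition (v : ℝ) :
    HasDerivAt Real.smoothTransition (deriv Real.smoothTransition v) v :=
  ((Real.smoothTransition.contDiff (n := 1)).differentiable (by simp) v).hasDerivAt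

lemma integral_mul_deriv_smoothTransition (g : ℝ → ℝ) (c m : ℝ) {δ : ℝ} (hδ : 0 < δ) :
    ∫ x, g x * (deriv Real.smoothTransition ((x - c) / δ + m) / δ) =
      ∫ v in (0 : ℝ)..1, g (c + δ * (v - m)) * deriv Real.smoothTransition v := by
  set k : ℝ → ℝ := fun v => g (c + δ * (v - m)) * deriv Real.smoothTransition v with hk
  have e : ∀ x, g x * (deriv Real.smoothTransition ((x - c) / δ + m) / δ) =
      δ⁻¹ * k ((x - c) / δ + m) := by
    intro x
    have : c + δ * ((x - c) / δ + m - m) = x := by field_simp; ring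
    simp only [hk, this]
    ring
  simp only [e]
  rw [integral_const_mul, integral_sub_right_eq_self (fun x => k (x / δ + m)) c,
    Measure.integral_comp_div (fun x => k (x + m)) δ, integral_add_right_eq_self k m,
    abs_of_pos hδ, smul_eq_mul, inv_mul_cancel_left₀ hδ.ne',
    intervalIntegral.integral_of_le zero_le_one, ← integral_Icc_eq_integral_Ioc,
    setIntegral_eq_integral_of_forall_compl_eq_zero]
  intro v hv
  simp [deriv_smoothTransition_eq_zero hv]

lemma integrable_mul_deriv_smoothTransition {g : ℝ → ℝ} (hg : Continuous g) (c m : ℝ) {δ : ℝ}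
    (hδ : 0 < δ) :
    Integrable fun x => g x * (deriv Real.smoothTransition ((x - c) / δ + m) / δ) := by
  refine Continuous.integrable_of_hasCompactSupport ?_ ?_
  · have := continuous_deriv_smoothTransition
    fun_prop
  · refine HasCompactSupport.intro (isCompact_Icc (a := c - δ * m) (b := c + δ - δ * m)) ?_
    intro x hx
    have : (x - c) / δ + m ∉ Icc (0 : ℝ) 1 := by
      intro h
      refine hx ⟨?_, ?_⟩
      · have := mul_nonneg hδ.le h.1
        rw [mul_add, mul_div_cancel₀ _ hδ.ne'] at this
        linarith
      · have := mul_le_mul_of_nonneg_left h.2 hδ.le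
        rw [mul_add, mul_div_cancel₀ _ hδ.ne'] at this
        linarith
    simp [deriv_smoothTransition_eq_zero this]

/-- The plane region between two graphs over a vertical interval. -/
def region (c₀ c₁ : ℝ → ℝ) (y₁ y₂ : ℝ) : Set Plane :=
  {z | (y₁ < z 1 ∧ z 1 < y₂) ∧ c₀ (z 1) < z 0 ∧ z 0 < c₁ (z 1)}

/-- A test function which approximates minus the indicator of a region. -/
def regionBump (c₀ c₁ : ℝ → ℝ) (y₁ y₂ ρ δ : ℝ) (z : Plane) : ℝ :=
  bump y₁ y₂ ρ (z 1) * (Real.smoothTransition ((z 0 - c₁ (z 1)) / δ + 2) -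
    Real.smoothTransition ((z 0 - c₀ (z 1)) / δ + -1))

section region

variable {c₀ c₁ : ℝ → ℝ} (h₀ : ContDiff ℝ 1 c₀) (h₁ : ContDiff ℝ 1 c₁) {y₁ y₂ : ℝ}

lemma abs_regionBump_le (c₀ c₁ : ℝ → ℝ) (y₁ y₂ ρ δ : ℝ) (z : Plane) :
    |regionBump c₀ c₁ y₁ y₂ ρ δ z| ≤ 1 := by
  rw [regionBump, abs_mul, abs_of_nonneg (bump_nonneg _ _ _ _)]
  refine mul_le_one₀ (bump_le_one _ _ _ _) (abs_nonneg _) ?_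
  rw [abs_le]
  constructor <;>
  linarith [Real.smoothTransition.nonneg ((z 0 - c₁ (z 1)) / δ + 2),
    Real.smoothTransition.le_one ((z 0 - c₁ (z 1)) / δ + 2),
    Real.smoothTransition.nonneg ((z 0 - c₀ (z 1)) / δ + -1),
    Real.smoothTransition.le_one ((z 0 - c₀ (z 1)) / δ + -1)]

lemma regionBump_eq_zero {ρ δ : ℝ} (hρ : 0 < ρ) (hδ : 0 < δ)
    (hc : ∀ y ∈ Icc (y₁ + ρ) (y₂ - ρ), 3 * δ ≤ c₁ y - c₀ y) {z : Plane}
    (hz : ¬ (z 1 ∈ Icc (y₁ + ρ) (y₂ - ρ) ∧ c₀ (z 1) + δ ≤ z 0 ∧ z 0 ≤ c₁ (z 1) - δ)) :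
    regionBump c₀ c₁ y₁ y₂ ρ δ z = 0 := by
  by_cases hy : z 1 ∈ Icc (y₁ + ρ) (y₂ - ρ)
  · have h3 := hc _ hy
    have hz' : z 0 < c₀ (z 1) + δ ∨ c₁ (z 1) - δ < z 0 := by
      by_contra! h
      exact hz ⟨hy, h⟩
    have e : Real.smoothTransition ((z 0 - c₁ (z 1)) / δ + 2) =
        Real.smoothTransition ((z 0 - c₀ (z 1)) / δ + -1) := by
      rcases hz' with h | h
      · rw [Real.smoothTransition.zero_of_nonpos, Real.smoothTransition.zero_of_nonpos]
        · rw [← sub_eq_add_neg, sub_nonpos, div_le_one hδ]; linarith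
        · rw [← le_neg_iff_add_nonpos_right, div_le_iff₀ hδ]; linarith
      · rw [Real.smoothTransition.one_of_one_le, Real.smoothTransition.one_of_one_le]
        · rw [← sub_eq_add_neg, le_sub_iff_add_le, le_div_iff₀ hδ]; linarith
        · rw [← sub_le_iff_le_add, le_div_iff₀ hδ]; linarith
    rw [regionBump, e, sub_self, mul_zero]
  · rw [regionBump, bump_eq_zero hρ hy, zero_mul]

include h₀ h₁

lemma contDiff_regionBump (ρ δ : ℝ) : ContDiff ℝ 1 (regionBump c₀ c₁ y₁ y₂ ρ δ) := by
  have hs : ContDiff ℝ 1 Real.smoothTransition := Real.smoothTransition.contDiff (n := 1)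
  have p0 : ContDiff ℝ 1 fun z : Plane => z 0 := by fun_prop
  have p1 : ContDiff ℝ 1 fun z : Plane => z 1 := by fun_prop
  exact ((contDiff_bump y₁ y₂ ρ 1).comp p1).mul
    ((hs.comp (((p0.sub (h₁.comp p1)).div_const δ).add contDiff_const)).sub
      (hs.comp (((p0.sub (h₀.comp p1)).div_const δ).add contDiff_const)))

lemma pd_regionBump (ρ δ : ℝ) (z : Plane) : pd 0 (regionBump c₀ c₁ y₁ y₂ ρ δ) z =
    bump y₁ y₂ ρ (z 1) * (deriv Real.smoothTransition ((z 0 - c₁ (z 1)) / δ + 2) / δ -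
      deriv Real.smoothTransition ((z 0 - c₀ (z 1)) / δ + -1) / δ) := by
  refine pd_eq_of_hasDerivAt ((contDiff_regionBump h₀ h₁ ρ δ).differentiable one_ne_zero z) ?_
  have key : ∀ a m : ℝ, HasDerivAt (fun t : ℝ => Real.smoothTransition ((z 0 + t - a) / δ + m))
      (deriv Real.smoothTransition ((z 0 - a) / δ + m) / δ) 0 := by
    intro a m
    have d1 : HasDerivAt (fun t : ℝ => (z 0 + t - a) / δ + m) (1 / δ) 0 :=
      ((((hasDerivAt_id (0:ℝ)).const_add (z 0)).sub_const a).div_const δ).add_const m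
    have d2 := hasDerivAt_smoothTransition ((z 0 + 0 - a) / δ + m)
    have := d2.comp (0:ℝ) d1
    rw [add_zero, mul_one_div] at this
    exact this
  have := ((key (c₁ (z 1)) 2).sub (key (c₀ (z 1)) (-1))).const_mul (bump y₁ y₂ ρ (z 1))
  refine this.congr_of_eventuallyEq (Filter.Eventually.of_forall fun t => ?_)
  simp [regionBump, e2]

lemma exists_compact_regionBump {ρ δ : ℝ} (hρ : 0 < ρ) (hδ : 0 < δ)
    (hc : ∀ y ∈ Icc (y₁ + ρ) (y₂ - ρ), 3 * δ ≤ c₁ y - c₀ y) :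
    ∃ K, IsCompact K ∧ K ⊆ region c₀ c₁ y₁ y₂ ∧
      ∀ z ∉ K, regionBump c₀ c₁ y₁ y₂ ρ δ z = 0 := by
  have hc0 := h₀.continuous
  have hc1 := h₁.continuous
  refine ⟨(fun q : ℝ × ℝ => (!₂[c₀ q.2 + δ + q.1 * (c₁ q.2 - c₀ q.2 - 2 * δ), q.2] : Plane)) ''
    (Icc 0 1 ×ˢ Icc (y₁ + ρ) (y₂ - ρ)), ?_, ?_, ?_⟩
  · exact (isCompact_Icc.prod isCompact_Icc).image (by fun_prop)
  · rintro _ ⟨⟨t, y⟩, ⟨⟨ht0, ht1⟩, hy⟩, rfl⟩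
    have h3 := hc y hy
    simp only [region, mem_ofPred_eq, Matrix.cons_val_zero, Matrix.cons_val_one]
    have := hy.1
    have := hy.2
    refine ⟨⟨by linarith, by linarith⟩, ?_, ?_⟩ <;> nlinarith
  · intro z hz
    refine regionBump_eq_zero hρ hδ hc fun h => hz ?_
    obtain ⟨hy, ha, hb⟩ := h
    have h3 := hc _ hy
    have hpos : 0 < c₁ (z 1) - c₀ (z 1) - 2 * δ := by linarith
    refine ⟨((z 0 - c₀ (z 1) - δ) / (c₁ (z 1) - c₀ (z 1) - 2 * δ), z 1), ⟨⟨?_, ?_⟩, hy⟩, ?_⟩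
    · exact div_nonneg (by linarith) hpos.le
    · rw [div_le_one hpos]; linarith
    · ext i
      fin_cases i
      · simp [hpos.ne']
      · simp

end region

lemma integral_mul_pd_regionBump {G : ℝ → ℝ → ℝ} (hG : Continuous (Function.uncurry G))
    {c₀ c₁ : ℝ → ℝ} (h₀ : ContDiff ℝ 1 c₀) (h₁ : ContDiff ℝ 1 c₁) {y₁ y₂ : ℝ} (hy : y₁ ≤ y₂)
    {ρ δ : ℝ} (hρ : 0 < ρ) (hδ : 0 < δ)
    (hc : ∀ y ∈ Icc (y₁ + ρ) (y₂ - ρ), 3 * δ ≤ c₁ y - c₀ y) :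
    ∫ z : Plane, G (z 0) (z 1) * pd 0 (regionBump c₀ c₁ y₁ y₂ ρ δ) z =
      ∫ y in y₁..y₂, bump y₁ y₂ ρ y * ∫ v in (0 : ℝ)..1, (G (c₁ y + δ * (v - 2)) y -
        G (c₀ y + δ * (v - -1)) y) * deriv Real.smoothTransition v := by
  have hGx : ∀ y, Continuous fun x => G x y := fun y =>
    hG.comp (f := fun x => (x, y)) (by fun_prop)
  have hint : Integrable fun z : Plane => G (z 0) (z 1) *
      pd 0 (regionBump c₀ c₁ y₁ y₂ ρ δ) z := by
    obtain ⟨K, hK, -, hz⟩ := exists_compact_regionBump h₀ h₁ hρ hδ hc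
    refine Continuous.integrable_of_hasCompactSupport ?_ (HasCompactSupport.intro hK fun z hzK => ?_)
    · exact (hG.comp (f := fun z : Plane => (z 0, z 1)) (by fun_prop)).mul
        (continuous_pd (contDiff_regionBump h₀ h₁ ρ δ) 0)
    · rw [pd_eq_zero hK.isClosed hz 0 hzK, mul_zero]
  simp only [pd_regionBump h₀ h₁] at hint ⊢
  rw [integral_plane (F := fun x y => G x y * (bump y₁ y₂ ρ y *
    (deriv Real.smoothTransition ((x - c₁ y) / δ + 2) / δ -
      deriv Real.smoothTransition ((x - c₀ y) / δ + -1) / δ))) hint,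
    intervalIntegral.integral_of_le hy, ← integral_Icc_eq_integral_Ioc,
    setIntegral_eq_integral_of_forall_compl_eq_zero]
  · refine integral_congr_ae (Filter.Eventually.of_forall fun y => ?_)
    have i₁ := integrable_mul_deriv_smoothTransition (hGx y) (c₁ y) 2 hδ
    have i₀ := integrable_mul_deriv_smoothTransition (hGx y) (c₀ y) (-1) hδ
    have e : ∀ x, G x y * (bump y₁ y₂ ρ y *
        (deriv Real.smoothTransition ((x - c₁ y) / δ + 2) / δ -
          deriv Real.smoothTransition ((x - c₀ y) / δ + -1) / δ)) = bump y₁ y₂ ρ y *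
        (G x y * (deriv Real.smoothTransition ((x - c₁ y) / δ + 2) / δ) -
          G x y * (deriv Real.smoothTransition ((x - c₀ y) / δ + -1) / δ)) := fun x => by ring
    simp only [e]
    rw [integral_const_mul, integral_sub i₁ i₀, integral_mul_deriv_smoothTransition _ _ _ hδ,
      integral_mul_deriv_smoothTransition _ _ _ hδ, ← intervalIntegral.integral_sub]
    · simp only [sub_mul]
    · refine Continuous.intervalIntegrable ?_ _ _
      exact ((hGx y).comp (by fun_prop)).mul continuous_deriv_smoothTransition
    · refine Continuous.intervalIntegrable ?_ _ _
      exact ((hGx y).comp (by fun_prop)).mul continuous_deriv_smoothTransition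
  · intro y hy'
    rw [bump_eq_zero hρ fun h => hy' ⟨by linarith [h.1], by linarith [h.2]⟩, zero_mul]

lemma tendsto_integral_bump_mul {L : ℝ → ℝ} (hL : Continuous L) {y₁ y₂ : ℝ} (hy : y₁ < y₂) :
    Filter.Tendsto (fun ρ => ∫ y in y₁..y₂, bump y₁ y₂ ρ y * L y) (nhdsWithin 0 (Ioi 0))
      (nhds (∫ y in y₁..y₂, L y)) := by
  refine intervalIntegral.tendsto_integral_filter_of_dominated_convergence (fun y => |L y|)
    (Filter.Eventually.of_forall fun ρ =>
      ((contDiff_bump y₁ y₂ ρ 1).continuous.mul hL).aestronglyMeasurable)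
    (Filter.Eventually.of_forall fun ρ => Filter.Eventually.of_forall fun y _ => ?_)
    (hL.abs.intervalIntegrable _ _) ?_
  · rw [Real.norm_eq_abs, abs_mul, abs_of_nonneg (bump_nonneg _ _ _ _)]
    exact mul_le_of_le_one_left (abs_nonneg _) (bump_le_one _ _ _ _)
  · have hne : ∀ᵐ y : ℝ, y ≠ y₂ := by simp [ae_iff]
    filter_upwards [hne] with y hy2 hy'
    rw [uIoc_of_le hy.le] at hy'
    have hlt : y < y₂ := lt_of_le_of_ne hy'.2 hy2
    refine tendsto_const_nhds.congr' ?_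
    filter_upwards [Ioo_mem_nhdsGT (show 0 < min ((y - y₁) / 2) ((y₂ - y) / 2) from
      lt_min (by linarith [hy'.1]) (by linarith))] with ρ hρ
    have h1 := hρ.2.trans_le (min_le_left _ _)
    have h2 := hρ.2.trans_le (min_le_right _ _)
    rw [bump_eq_one hρ.1 ⟨by linarith, by linarith⟩, one_mul]

/-- Test functions supported in a region between two graphs detect the increment of a continuous
function across the region. -/
lemma exists_test_region {G : ℝ → ℝ → ℝ} (hG : Continuous (Function.uncurry G))
    {c₀ c₁ : ℝ → ℝ} (h₀ : ContDiff ℝ 1 c₀) (h₁ : ContDiff ℝ 1 c₁) {y₁ y₂ : ℝ} (hy : y₁ < y₂)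
    (hc : ∀ y ∈ Ioo y₁ y₂, c₀ y < c₁ y) {η : ℝ} (hη : 0 < η) :
    ∃ ξ : Plane → ℝ, ContDiff ℝ 1 ξ ∧ (∃ K, IsCompact K ∧ K ⊆ region c₀ c₁ y₁ y₂ ∧
      ∀ z ∉ K, ξ z = 0) ∧ (∀ z, |ξ z| ≤ 1) ∧
      (∫ y in y₁..y₂, (G (c₁ y) y - G (c₀ y) y)) - η < ∫ z : Plane, G (z 0) (z 1) * pd 0 ξ z := by
  have k₀ := h₀.continuous
  have k₁ := h₁.continuous
  have hG' : ∀ {α : Type} [TopologicalSpace α] {u v : α → ℝ}, Continuous u → Continuous v →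
      Continuous fun a => G (u a) (v a) := fun hu hv => hG.comp (hu.prodMk hv)
  have hs := continuous_deriv_smoothTransition
  have hL : Continuous fun y => G (c₁ y) y - G (c₀ y) y :=
    (hG' k₁ continuous_id).sub (hG' k₀ continuous_id)
  obtain ⟨ρ, hρJ, hρ⟩ := (((tendsto_integral_bump_mul hL hy).eventually_const_lt
    (show (∫ y in y₁..y₂, (G (c₁ y) y - G (c₀ y) y)) - η < _ by linarith)).and
    (Ioo_mem_nhdsGT (show 0 < (y₂ - y₁) / 2 by linarith))).exists
  set J : ℝ → ℝ := fun δ => ∫ y in y₁..y₂, bump y₁ y₂ ρ y * ∫ v in (0 : ℝ)..1,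
    (G (c₁ y + δ * (v - 2)) y - G (c₀ y + δ * (v - -1)) y) * deriv Real.smoothTransition v with hJ
  have hJ0 : J 0 = ∫ y in y₁..y₂, bump y₁ y₂ ρ y * (G (c₁ y) y - G (c₀ y) y) := by
    simp only [hJ, zero_mul, add_zero, intervalIntegral.integral_const_mul,
      integral_deriv_smoothTransition, mul_one]
  have hJc : Continuous J := by
    refine intervalIntegral.continuous_parametric_intervalIntegral_of_continuous' (f := fun δ y =>
      bump y₁ y₂ ρ y * ∫ v in (0 : ℝ)..1, (G (c₁ y + δ * (v - 2)) y -
        G (c₀ y + δ * (v - -1)) y) * deriv Real.smoothTransition v) ?_ _ _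
    refine ((contDiff_bump y₁ y₂ ρ 1).continuous.comp continuous_snd).mul ?_
    refine intervalIntegral.continuous_parametric_intervalIntegral_of_continuous'
      (f := fun (q : ℝ × ℝ) v => (G (c₁ q.2 + q.1 * (v - 2)) q.2 -
        G (c₀ q.2 + q.1 * (v - -1)) q.2) * deriv Real.smoothTransition v) ?_ _ _
    refine Continuous.mul (Continuous.sub (hG' ?_ ?_) (hG' ?_ ?_)) ?_ <;> fun_prop
  rw [← hJ0] at hρJ
  have hev : ∀ᶠ δ in nhdsWithin (0 : ℝ) (Ioi 0),
      (∫ y in y₁..y₂, (G (c₁ y) y - G (c₀ y) y)) - η < J δ :=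
    ((hJc.tendsto 0).eventually_const_lt hρJ).filter_mono nhdsWithin_le_nhds
  obtain ⟨m, hm, hmc⟩ : ∃ m > 0, ∀ y ∈ Icc (y₁ + ρ) (y₂ - ρ), m ≤ c₁ y - c₀ y := by
    obtain ⟨y, hyI, hmin⟩ := (isCompact_Icc (a := y₁ + ρ) (b := y₂ - ρ)).exists_isMinOn
      (nonempty_Icc.2 (by linarith [hρ.2])) (k₁.sub k₀).continuousOn
    refine ⟨c₁ y - c₀ y, sub_pos.2 (hc y ⟨?_, ?_⟩), fun x hx => hmin hx⟩ <;>
      linarith [hyI.1, hyI.2, hρ.1]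
  obtain ⟨δ, hδJ, hδ⟩ := (hev.and (Ioo_mem_nhdsGT (show 0 < m / 3 by linarith))).exists
  have hδm : ∀ y ∈ Icc (y₁ + ρ) (y₂ - ρ), 3 * δ ≤ c₁ y - c₀ y := fun y hyI => by
    linarith [hmc y hyI, hδ.2]
  refine ⟨regionBump c₀ c₁ y₁ y₂ ρ δ, contDiff_regionBump h₀ h₁ ρ δ,
    exists_compact_regionBump h₀ h₁ hρ.1 hδ.1 hδm, abs_regionBump_le _ _ _ _ _ _, ?_⟩
  rwa [integral_mul_pd_regionBump hG h₀ h₁ hy.le hρ.1 hδ.1 hδm]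

lemma isOpen_region {c₀ c₁ : ℝ → ℝ} (h₀ : Continuous c₀) (h₁ : Continuous c₁) (y₁ y₂ : ℝ) :
    IsOpen (region c₀ c₁ y₁ y₂) := by
  have p0 : Continuous fun z : Plane => z 0 := by fun_prop
  have p1 : Continuous fun z : Plane => z 1 := by fun_prop
  exact ((isOpen_lt continuous_const p1).inter (isOpen_lt p1 continuous_const)).inter
    ((isOpen_lt (h₀.comp p1) p0).inter (isOpen_lt p0 (h₁.comp p1)))

/-- The interior of a triangle in a closed half-plane lies in the open half-plane. -/
lemma lt_of_mem_interior_triangle {p q r z : Plane} {a b c : ℝ} (hab : a ≠ 0 ∨ b ≠ 0)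
    (hp : a * p 0 + b * p 1 ≤ c) (hq : a * q 0 + b * q 1 ≤ c) (hr : a * r 0 + b * r 1 ≤ c)
    (hz : z ∈ interior (convexHull ℝ {p, q, r})) : a * z 0 + b * z 1 < c := by
  have hle : convexHull ℝ {p, q, r} ⊆ {z : Plane | a * z 0 + b * z 1 ≤ c} := by
    refine convexHull_min ?_ ?_
    · rintro x (rfl | rfl | rfl) <;> assumption
    · intro x hx y hy s t hs ht hst
      simp only [mem_ofPred_eq, PiLp.add_apply, PiLp.smul_apply, smul_eq_mul] at hx hy ⊢
      have e : c = s * c + t * c := by rw [← add_mul, hst, one_mul]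
      have := mul_le_mul_of_nonneg_left hx hs
      have := mul_le_mul_of_nonneg_left hy ht
      linarith
  have hcont : Continuous fun t : ℝ => z + t • (!₂[a, b] : Plane) := by fun_prop
  have h0 : ∀ᶠ t in nhds (0 : ℝ), z + t • (!₂[a, b] : Plane) ∈ convexHull ℝ {p, q, r} := by
    refine hcont.continuousAt.eventually_mem ?_
    rw [zero_smul, add_zero]
    exact mem_interior_iff_mem_nhds.1 hz
  obtain ⟨t, ht, htpos⟩ := ((h0.filter_mono nhdsWithin_le_nhds).and
    (self_mem_nhdsWithin (s := Ioi (0 : ℝ)))).exists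
  have h1 := hle ht
  simp only [mem_ofPred_eq, PiLp.add_apply, PiLp.smul_apply, smul_eq_mul,
    Matrix.cons_val_zero, Matrix.cons_val_one] at h1
  have h2 : 0 < a * a + b * b := by
    rcases hab with h | h <;> nlinarith [mul_self_pos.2 h, mul_self_nonneg a, mul_self_nonneg b]
  have := mul_pos (show (0:ℝ) < t from htpos) h2
  nlinarith

lemma mem_triangle {p q r z : Plane} {α β γ : ℝ} (hα : 0 ≤ α) (hβ : 0 ≤ β) (hγ : 0 ≤ γ)
    (h : α + β + γ = 1) (h0 : α * p 0 + β * q 0 + γ * r 0 = z 0)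
    (h1 : α * p 1 + β * q 1 + γ * r 1 = z 1) : z ∈ convexHull ℝ {p, q, r} := by
  have hz : z = α • p + β • q + γ • r := by
    ext i
    fin_cases i
    · exact h0.symm
    · exact h1.symm
  have hmem : ∀ x ∈ ({p, q, r} : Set Plane), x ∈ convexHull ℝ {p, q, r} :=
    fun x hx => subset_convexHull ℝ _ hx
  have := (convex_convexHull ℝ ({p, q, r} : Set Plane)).sum_mem (t := Finset.univ)
    (w := ![α, β, γ]) (z := ![p, q, r]) (by intro i _; fin_cases i <;> assumption)
    (by simpa [Fin.sum_univ_three] using h)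
    (by intro i _; fin_cases i <;> exact hmem _ (by simp))
  rw [hz]
  simpa [Fin.sum_univ_three] using this

/-- The diagonal of a rectangle, as a function of the second coordinate. -/
def rectDiag (P R y₁ y₂ y : ℝ) : ℝ := P + (R - P) / (y₂ - y₁) * (y - y₁)

/-- The two triangles into which a diagonal divides a rectangle. -/
def halfRect (P R y₁ y₂ : ℝ) : Bool → Set Plane
  | false => interior (convexHull ℝ {!₂[P, y₁], !₂[P, y₂], !₂[R, y₂]})
  | true => interior (convexHull ℝ {!₂[P, y₁], !₂[R, y₁], !₂[R, y₂]})

/-- The left boundary of a half of a rectangle. -/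
def halfLeft (P R y₁ y₂ : ℝ) : Bool → ℝ → ℝ
  | false => fun _ => P
  | true => rectDiag P R y₁ y₂

/-- The right boundary of a half of a rectangle. -/
def halfRight (P R y₁ y₂ : ℝ) : Bool → ℝ → ℝ
  | false => rectDiag P R y₁ y₂
  | true => fun _ => R

lemma contDiff_rectDiag (P R y₁ y₂ : ℝ) : ContDiff ℝ 1 (rectDiag P R y₁ y₂) := by
  unfold rectDiag
  fun_prop

lemma contDiff_halfLeft (P R y₁ y₂ : ℝ) (b : Bool) : ContDiff ℝ 1 (halfLeft P R y₁ y₂ b) := by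
  cases b
  · exact contDiff_const
  · exact contDiff_rectDiag P R y₁ y₂

lemma contDiff_halfRight (P R y₁ y₂ : ℝ) (b : Bool) : ContDiff ℝ 1 (halfRight P R y₁ y₂ b) := by
  cases b
  · exact contDiff_rectDiag P R y₁ y₂
  · exact contDiff_const

lemma isOpenTriangle_halfRect (P R y₁ y₂ : ℝ) (b : Bool) :
    IsOpenTriangle (halfRect P R y₁ y₂ b) := by
  cases b <;> exact ⟨_, _, _, rfl⟩

section halves

variable {P R y₁ y₂ : ℝ} (hPR : P < R) (hy : y₁ < y₂)

include hPR hy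

lemma halfLeft_lt_halfRight (b : Bool) {y : ℝ} (hyI : y ∈ Ioo y₁ y₂) :
    halfLeft P R y₁ y₂ b y < halfRight P R y₁ y₂ b y := by
  have hd : 0 < y₂ - y₁ := sub_pos.2 hy
  have h1 : 0 < (R - P) / (y₂ - y₁) := div_pos (sub_pos.2 hPR) hd
  have h2 : (R - P) / (y₂ - y₁) * (y₂ - y₁) = R - P := div_mul_cancel₀ _ hd.ne'
  have h3 := mul_pos h1 (sub_pos.2 hyI.1)
  have h4 := mul_pos h1 (sub_pos.2 hyI.2)
  cases b <;> simp only [halfLeft, halfRight, rectDiag] <;> nlinarith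

lemma region_subset_halfRect (b : Bool) :
    region (halfLeft P R y₁ y₂ b) (halfRight P R y₁ y₂ b) y₁ y₂ ⊆ halfRect P R y₁ y₂ b := by
  have ho := isOpen_region (contDiff_halfLeft P R y₁ y₂ b).continuous
    (contDiff_halfRight P R y₁ y₂ b).continuous y₁ y₂
  have hd : 0 < y₂ - y₁ := sub_pos.2 hy
  have hw : 0 < R - P := sub_pos.2 hPR
  have key : ∀ u y, P + (R - P) / (y₂ - y₁) * (y - y₁) - u =
      (R - P) * ((y - y₁) / (y₂ - y₁) - (u - P) / (R - P)) := by
    intro u y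
    field_simp
    ring
  have e1 : ∀ y, (y - y₁) / (y₂ - y₁) * (y₂ - y₁) = y - y₁ := fun y => div_mul_cancel₀ _ hd.ne'
  have e2 : ∀ u, (u - P) / (R - P) * (R - P) = u - P := fun u => div_mul_cancel₀ _ hw.ne'
  cases b
  · refine interior_maximal ?_ ho
    rintro z ⟨⟨hz1, hz2⟩, hz3, hz4⟩
    simp only [halfLeft, halfRight, rectDiag] at hz3 hz4
    have hk := key (z 0) (z 1)
    have a1 := e1 (z 1)
    have a2 := e2 (z 0)
    set s := (z 1 - y₁) / (y₂ - y₁)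
    set t := (z 0 - P) / (R - P)
    refine mem_triangle (α := 1 - s) (β := s - t) (γ := t) ?_ ?_ ?_ (by ring) ?_ ?_
    · nlinarith
    · nlinarith
    · nlinarith
    · simp only [Matrix.cons_val_zero]; linarith
    · simp only [Matrix.cons_val_one, Matrix.cons_val_zero]; linarith
  · refine interior_maximal ?_ ho
    rintro z ⟨⟨hz1, hz2⟩, hz3, hz4⟩
    simp only [halfLeft, halfRight, rectDiag] at hz3 hz4
    have hk := key (z 0) (z 1)
    have a1 := e1 (z 1)
    have a2 := e2 (z 0)
    set s := (z 1 - y₁) / (y₂ - y₁)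
    set t := (z 0 - P) / (R - P)
    refine mem_triangle (α := 1 - t) (β := t - s) (γ := s) ?_ ?_ ?_ (by ring) ?_ ?_
    · nlinarith
    · nlinarith
    · nlinarith
    · simp only [Matrix.cons_val_zero]; linarith
    · simp only [Matrix.cons_val_one, Matrix.cons_val_zero]; linarith

lemma halfRect_subset_rect (b : Bool) {z : Plane} (hz : z ∈ halfRect P R y₁ y₂ b) :
    z 0 ∈ Ioo P R ∧ z 1 ∈ Ioo y₁ y₂ := by
  cases b <;> simp only [halfRect] at hz
  all_goals
    have a1 := lt_of_mem_interior_triangle (a := -1) (b := 0) (c := -P) (by norm_num)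
      (by simp) (by simp [hPR.le]) (by simp [hPR.le]) hz
    have a2 := lt_of_mem_interior_triangle (a := 1) (b := 0) (c := R) (by norm_num)
      (by simp [hPR.le]) (by simp [hPR.le]) (by simp) hz
    have a3 := lt_of_mem_interior_triangle (a := 0) (b := -1) (c := -y₁) (by norm_num)
      (by simp) (by simp [hy.le]) (by simp [hy.le]) hz
    have a4 := lt_of_mem_interior_triangle (a := 0) (b := 1) (c := y₂) (by norm_num)
      (by simp [hy.le]) (by simp [hy.le]) (by simp) hz
    exact ⟨⟨by linarith, by linarith⟩, by linarith, by linarith⟩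

lemma disjoint_halfRect : Disjoint (halfRect P R y₁ y₂ false) (halfRect P R y₁ y₂ true) := by
  rw [Set.disjoint_left]
  intro z hz1 hz2
  have hd : 0 < y₂ - y₁ := sub_pos.2 hy
  have hw : 0 < R - P := sub_pos.2 hPR
  have a1 := lt_of_mem_interior_triangle (a := y₂ - y₁) (b := -(R - P))
    (c := (y₂ - y₁) * P - (R - P) * y₁) (Or.inl hd.ne')
    (by simp only [Matrix.cons_val_one, Matrix.cons_val_zero]; linarith)
    (by simp only [Matrix.cons_val_one, Matrix.cons_val_zero]; nlinarith)
    (by simp only [Matrix.cons_val_one, Matrix.cons_val_zero]; linarith) hz1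
  have a2 := lt_of_mem_interior_triangle (a := -(y₂ - y₁)) (b := R - P)
    (c := -((y₂ - y₁) * P - (R - P) * y₁)) (Or.inl (by linarith))
    (by simp only [Matrix.cons_val_one, Matrix.cons_val_zero]; linarith)
    (by simp only [Matrix.cons_val_one, Matrix.cons_val_zero]; nlinarith)
    (by simp only [Matrix.cons_val_one, Matrix.cons_val_zero]; linarith) hz2
  linarith

end halves

lemma integrable_mul_pd {G : ℝ → ℝ → ℝ} (hG : Continuous (Function.uncurry G)) {ξ : Plane → ℝ}
    (hξ : ContDiff ℝ 1 ξ) {K : Set Plane} (hK : IsCompact K) (hz : ∀ z ∉ K, ξ z = 0) :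
    Integrable fun z : Plane => G (z 0) (z 1) * pd 0 ξ z := by
  refine Continuous.integrable_of_hasCompactSupport ?_ (HasCompactSupport.intro hK fun z hzK => ?_)
  · exact (hG.comp (f := fun z : Plane => (z 0, z 1)) (by fun_prop)).mul (continuous_pd hξ 0)
  · rw [pd_eq_zero hK.isClosed hz 0 hzK, mul_zero]

/-- A lower bound for the variation on a set containing disjoint regions between graphs. -/
lemma sum_integral_le_Var {ι : Type*} [Fintype ι] {G : ℝ → ℝ → ℝ}
    (hG : Continuous (Function.uncurry G)) {c₀ c₁ : ι → ℝ → ℝ} (h₀ : ∀ i, ContDiff ℝ 1 (c₀ i))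
    (h₁ : ∀ i, ContDiff ℝ 1 (c₁ i)) {y₁ y₂ : ℝ} (hy : y₁ < y₂)
    (hc : ∀ i, ∀ y ∈ Ioo y₁ y₂, c₀ i y < c₁ i y) {E : Set Plane}
    (hE : ∀ i, region (c₀ i) (c₁ i) y₁ y₂ ⊆ E)
    (hdisj : ∀ i j, i ≠ j → Disjoint (region (c₀ i) (c₁ i) y₁ y₂) (region (c₀ j) (c₁ j) y₁ y₂))
    {g : Plane → Plane} (hg : ∀ z ∈ E, g z 0 = G (z 0) (z 1)) (hbdd : BddAbove (varSet g E)) :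
    ∑ i, ∫ y in y₁..y₂, (G (c₁ i y) y - G (c₀ i y) y) ≤ Var g E := by
  refine le_of_forall_pos_sub_le fun η hη => ?_
  have hN : (0 : ℝ) < Fintype.card ι + 1 := by positivity
  choose ξ hξ hK hb hlt using fun i => exists_test_region hG (h₀ i) (h₁ i) hy (hc i)
    (div_pos hη hN)
  choose K hKc hKr hz using hK
  have hsum : ∀ z, (∀ i, ξ i z = 0) ∨ ∃ i, ∑ j, ξ j z = ξ i z := by
    intro z
    by_cases h : ∃ i, z ∈ K i
    · obtain ⟨i, hi⟩ := h
      refine Or.inr ⟨i, Finset.sum_eq_single i (fun j _ hji => hz j z fun hj => ?_) (by simp)⟩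
      exact Set.disjoint_left.1 (hdisj j i hji) (hKr j hj) (hKr i hi)
    · exact Or.inl fun i => hz i z fun hi => h ⟨i, hi⟩
  set p : Fin 2 → Fin 2 → Plane → ℝ := fun a b z =>
    if a = 0 ∧ b = 0 then ∑ i, ξ i z else 0 with hp
  have htest : IsTest E p := by
    refine ⟨fun a b => ?_, ⋃ i, K i, isCompact_iUnion hKc,
      iUnion_subset fun i => (hKr i).trans (hE i), fun a b z hzK => ?_⟩
    · by_cases h : a = 0 ∧ b = 0
      · simpa only [hp, h, and_self, if_true] using ContDiff.sum fun i _ => hξ i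
      · simpa only [hp, h, if_false] using contDiff_const
    · have : ∀ i, ξ i z = 0 := fun i => hz i z fun hi => hzK (mem_iUnion.2 ⟨i, hi⟩)
      simp [hp, this]
  have hp1 : ∀ a b z, |p a b z| ≤ 1 := by
    intro a b z
    by_cases h : a = 0 ∧ b = 0
    · simp only [hp, h, and_self, if_true]
      rcases hsum z with h | ⟨i, h⟩
      · simp [h]
      · rw [h]
        exact hb i z
    · simp [hp, h]
  have hrow0 : ∀ z, rowDiv p 0 z = ∑ i, pd 0 (ξ i) z := by
    intro z
    have e0 : p 0 0 = fun z => ∑ i, ξ i z := by simp [hp]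
    have e1 : p 0 1 = fun _ => 0 := by simp [hp]
    rw [rowDiv, e0, e1, pd, pd, fderiv_fun_sum fun i _ => (hξ i).differentiable one_ne_zero z]
    simp [pd]
  have hrow1 : ∀ z, rowDiv p 1 z = 0 := by
    intro z
    have e0 : ∀ b, p 1 b = fun _ => 0 := by simp [hp]
    simp [rowDiv, e0, pd]
  have hpair : pairing g p E = ∑ i, ∫ z : Plane, G (z 0) (z 1) * pd 0 (ξ i) z := by
    rw [pairing_eq_integral g htest,
      ← integral_finsetSum _ fun i _ => integrable_mul_pd hG (hξ i) (hKc i) (hz i)]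
    refine integral_congr_ae (Filter.Eventually.of_forall fun z => ?_)
    simp only [pairingFun, hrow0, hrow1, mul_zero, add_zero, ← Finset.mul_sum]
    by_cases hzE : z ∈ E
    · rw [hg z hzE]
    · have : ∀ i, pd 0 (ξ i) z = 0 := fun i =>
        pd_eq_zero (hKc i).isClosed (hz i) 0 fun hi => hzE (hE i (hKr i hi))
      simp [this]
  have hle : pairing g p E ≤ Var g E := le_csSup hbdd ((mem_varSet_iff g E _).2 ⟨p, htest, hp1, rfl⟩)
  have h1 : ∑ i, ((∫ y in y₁..y₂, (G (c₁ i y) y - G (c₀ i y) y)) - η / (Fintype.card ι + 1)) ≤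
      pairing g p E := by
    rw [hpair]
    exact Finset.sum_le_sum fun i _ => (hlt i).le
  rw [Finset.sum_sub_distrib, Finset.sum_const, Finset.card_univ, nsmul_eq_mul] at h1
  have h2 : (Fintype.card ι : ℝ) * (η / (Fintype.card ι + 1)) ≤ η := by
    rw [← mul_div_assoc, div_le_iff₀ hN]
    nlinarith
  linarith

lemma volume_strip (a b : ℝ) :
    volume {z : Plane | z 0 ∈ Ioo a b ∧ z 1 ∈ Ioo (0 : ℝ) 1} = ENNReal.ofReal (b - a) := by
  have := measurePreserving_planeEquiv.measure_preimage
    ((measurableSet_Ioo (a := a) (b := b)).prod (measurableSet_Ioo (a := (0 : ℝ)) (b := 1))).nullMeasurableSet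
  rw [Measure.volume_eq_prod, Measure.prod_prod, Real.volume_Ioo, Real.volume_Ioo, sub_zero,
    ENNReal.ofReal_one, mul_one] at this
  exact this

/-- Given disjoint rectangles, a finite union of open triangles of at most the same measure on
which the variation is at least the sum of the mean increments across the rectangles. -/
lemma exists_triangles {k : ℕ} {P R : Fin k → ℝ} (hPR : ∀ i, P i < R i) (hP : ∀ i, 0 ≤ P i)
    (hR : ∀ i, R i ≤ 1) (hdisj : ∀ i j, i ≠ j → R i ≤ P j ∨ R j ≤ P i) {y₁ y₂ : ℝ} (h0 : 0 ≤ y₁)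
    (hy : y₁ < y₂) (h1 : y₂ ≤ 1) :
    ∃ E ⊆ unitSq, FinUnionTriangles E ∧ volume E ≤ ENNReal.ofReal (∑ i, (R i - P i)) ∧
      ∀ (G : ℝ → ℝ → ℝ) (g : Plane → Plane), Continuous (Function.uncurry G) →
        (∀ z ∈ unitSq, g z 0 = G (z 0) (z 1)) → BddAbove (varSet g unitSq) →
        ∑ i, ∫ y in y₁..y₂, (G (R i) y - G (P i) y) ≤ Var g E := by
  set T : Fin k × Bool → Set Plane := fun q => halfRect (P q.1) (R q.1) y₁ y₂ q.2 with hT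
  have hrect : ∀ q, ∀ z ∈ T q, z 0 ∈ Ioo (P q.1) (R q.1) ∧ z 1 ∈ Ioo y₁ y₂ :=
    fun q z hz => halfRect_subset_rect (hPR q.1) hy q.2 hz
  have hTd : ∀ q q', q ≠ q' → Disjoint (T q) (T q') := by
    rintro ⟨i, b⟩ ⟨j, b'⟩ hne
    by_cases hij : i = j
    · subst hij
      cases b <;> cases b'
      · exact absurd rfl hne
      · exact disjoint_halfRect (hPR i) hy
      · exact (disjoint_halfRect (hPR i) hy).symm
      · exact absurd rfl hne
    · rw [Set.disjoint_left]
      intro z hz hz'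
      have a1 := (hrect _ z hz).1
      have a2 := (hrect _ z hz').1
      simp only [mem_Ioo] at a1 a2
      rcases hdisj i j hij with h | h <;> linarith [a1.1, a1.2, a2.1, a2.2]
  have hE : ⋃ q, T q ⊆ unitSq := by
    refine iUnion_subset fun q z hz => ?_
    have a := hrect q z hz
    exact ⟨(hP _).trans_lt a.1.1, a.1.2.trans_le (hR _), h0.trans_lt a.2.1, a.2.2.trans_le h1⟩
  refine ⟨⋃ q, T q, hE, ?_, ?_, ?_⟩
  · let e := (Fintype.equivFin (Fin k × Bool)).symm
    exact ⟨_, fun i => T (e i), fun i => isOpenTriangle_halfRect _ _ _ _ _,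
      fun i j hij => hTd _ _ fun h => hij (e.injective h), (e.surjective.iUnion_comp T).symm⟩
  · have hsub : ⋃ q, T q ⊆ ⋃ i, {z : Plane | z 0 ∈ Ioo (P i) (R i) ∧ z 1 ∈ Ioo (0 : ℝ) 1} := by
      refine iUnion_subset fun q z hz => mem_iUnion.2 ⟨q.1, ?_⟩
      have a := hrect q z hz
      exact ⟨a.1, h0.trans_lt a.2.1, a.2.2.trans_le h1⟩
    refine (measure_mono hsub).trans ((measure_iUnion_fintype_le _ _).trans_eq ?_)
    simp only [volume_strip]
    rw [ENNReal.ofReal_sum_of_nonneg fun i _ => (sub_pos.2 (hPR i)).le]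
  · intro G g hG hg hb
    have hsub : ∀ q : Fin k × Bool, region (halfLeft (P q.1) (R q.1) y₁ y₂ q.2)
        (halfRight (P q.1) (R q.1) y₁ y₂ q.2) y₁ y₂ ⊆ T q :=
      fun q => region_subset_halfRect (hPR q.1) hy q.2
    have := sum_integral_le_Var hG (c₀ := fun q : Fin k × Bool => halfLeft (P q.1) (R q.1) y₁ y₂ q.2)
      (c₁ := fun q => halfRight (P q.1) (R q.1) y₁ y₂ q.2) (fun q => contDiff_halfLeft _ _ _ _ _)
      (fun q => contDiff_halfRight _ _ _ _ _) hy
      (fun q y hyI => halfLeft_lt_halfRight (hPR q.1) hy q.2 hyI)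
      (fun q => (hsub q).trans (subset_iUnion T q))
      (fun q q' hne => (hTd q q' hne).mono (hsub q) (hsub q')) (fun z hz => hg z (hE hz))
      (hb.mono (varSet_subset hE g))
    refine le_trans (le_of_eq ?_) this
    rw [Fintype.sum_prod_type]
    refine Finset.sum_congr rfl fun i _ => ?_
    have hi : ∀ u v : ℝ → ℝ, Continuous u → Continuous v →
        IntervalIntegrable (fun y => G (u y) y - G (v y) y) volume y₁ y₂ := fun u v hu hv =>
      ((hG.comp (hu.prodMk continuous_id)).sub
        (hG.comp (hv.prodMk continuous_id))).intervalIntegrable _ _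
    have hd := (contDiff_rectDiag (P i) (R i) y₁ y₂).continuous
    simp only [Fintype.sum_bool, halfLeft, halfRight]
    rw [← intervalIntegral.integral_add (hi _ _ continuous_const hd) (hi _ _ hd continuous_const)]
    simp only [sub_add_sub_cancel]

/-- The first component of a map continuous on the closed square extends continuously. -/
lemma exists_extension_fst {f : Plane → Plane} (hf : ContinuousOn f (closure unitSq)) :
    ∃ G : ℝ → ℝ → ℝ, Continuous (Function.uncurry G) ∧
      ∀ z ∈ closure unitSq, f z 0 = G (z 0) (z 1) := by
  refine ⟨fun x y => f !₂[max 0 (min 1 x), max 0 (min 1 y)] 0, ?_, fun z hz => ?_⟩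
  · have h : Continuous fun q : ℝ × ℝ => f !₂[max 0 (min 1 q.1), max 0 (min 1 q.2)] := by
      refine hf.comp_continuous (by fun_prop) fun q => mem_closure_unitSq ?_ ?_ ?_ ?_ <;> simp
    exact (PiLp.continuous_apply 2 _ 0).comp h
  · obtain ⟨h1, h2, h3, h4⟩ := closure_unitSq_subset hz
    have e : (!₂[max 0 (min 1 (z 0)), max 0 (min 1 (z 1))] : Plane) = z := by
      rw [min_eq_right h2, min_eq_right h4, max_eq_right h1, max_eq_right h3]
      ext i
      fin_cases i <;> rfl
    simp only [e]

/-- After a shear which compresses vertical strips, the variation on the compressed strips is still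
at least the sum of the mean increments across the original strips. -/
lemma ShearProfile.exists_triangles_precomp {β χ : ℝ → ℝ} {A κ C : ℝ}
    (h : ShearProfile β χ A κ C) {p : (Plane → Plane) × (Plane → Plane)}
    (hext : ExtendsToId p.1) (hBV : IsBV p.1 unitSq)
    {y₁ y₂ : ℝ} (hy1 : 0 ≤ y₁) (hy : y₁ < y₂) (hy2 : y₂ ≤ 1) (hχ : ∀ y ∈ Icc y₁ y₂, χ y = 1)
    {k : ℕ} {s u : Fin k → ℝ} (hsu : ∀ i, s i < u i) (hs : ∀ i, 0 ≤ s i) (hu : ∀ i, u i ≤ 1)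
    (hdisj : ∀ i j, i ≠ j → u i ≤ s j ∨ u j ≤ s i) :
    ∃ E ⊆ unitSq, FinUnionTriangles E ∧
      volume E ≤ ENNReal.ofReal (∑ i, ((u i + β (u i)) - (s i + β (s i)))) ∧
      ∑ i, ((∫ y in y₁..y₂, p.1 !₂[u i, y] 0) - ∫ y in y₁..y₂, p.1 !₂[s i, y] 0) ≤
        Var (h.precomp p).1 E := by
  set b : ℝ → ℝ := fun t => t + β t with hb
  have hbm : StrictMono b := by
    simpa [hχ y₁ ⟨le_rfl, hy.le⟩] using h.strictMono y₁
  have hb0 : b 0 = 0 := by simp [hb, h.β_zero]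
  have hb1 : b 1 = 1 := by simp [hb, h.β_one]
  obtain ⟨E, hE, hfin, hvol, hvar⟩ := exists_triangles (P := b ∘ s) (R := b ∘ u)
    (fun i => hbm (hsu i)) (fun i => hb0 ▸ hbm.monotone (hs i))
    (fun i => (hbm.monotone (hu i)).trans_eq hb1)
    (fun i j hij => (hdisj i j hij).imp (fun h => hbm.monotone h) (fun h => hbm.monotone h))
    hy1 hy hy2
  refine ⟨E, hE, hfin, hvol, ?_⟩
  obtain ⟨G, hG, hGeq⟩ := exists_extension_fst (h.extendsToId_precomp hext).1
  obtain ⟨F, hF, hFeq⟩ := exists_extension_fst hext.1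
  refine le_trans (le_of_eq (Finset.sum_congr rfl fun i _ => ?_))
    (hvar G _ hG (fun z hz => hGeq z (subset_closure hz)) (h.bddAbove_varSet hBV))
  have key : ∀ t ∈ Icc (0 : ℝ) 1, ∀ y ∈ Icc y₁ y₂,
      p.1 !₂[t, y] 0 = F t y ∧ G (b t) y = F t y := by
    intro t ht y hyI
    have hty : (!₂[t, y] : Plane) ∈ closure unitSq := mem_closure_unitSq ht.1 ht.2
      (hy1.trans hyI.1) (hyI.2.trans hy2)
    have e1 : p.1 !₂[t, y] 0 = F t y := hFeq _ hty
    have e2 : (!₂[b t, y] : Plane) = h.homeo !₂[t, y] := by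
      simp [shear, hχ y hyI, hb]
    have hbt : (!₂[b t, y] : Plane) ∈ closure unitSq := mem_closure_unitSq
      (hb0 ▸ hbm.monotone ht.1) ((hbm.monotone ht.2).trans_eq hb1)
      (hy1.trans hyI.1) (hyI.2.trans hy2)
    have e3 : (h.precomp p).1 !₂[b t, y] 0 = G (b t) y := hGeq _ hbt
    refine ⟨e1, ?_⟩
    rw [← e3, ← e1, e2]
    simp only [ShearProfile.precomp, Function.comp_apply, Homeomorph.symm_apply_apply]
  have hmem : s i ∈ Icc (0 : ℝ) 1 ∧ u i ∈ Icc (0 : ℝ) 1 :=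
    ⟨⟨hs i, (hsu i).le.trans (hu i)⟩, (hs i).trans (hsu i).le, hu i⟩
  have hint : ∀ t, IntervalIntegrable (fun y => F t y) volume y₁ y₂ := fun t =>
    (hF.comp (f := fun y => (t, y)) (by fun_prop)).intervalIntegrable _ _
  have hI : ∀ t ∈ Icc (0 : ℝ) 1, ∫ y in y₁..y₂, p.1 !₂[t, y] 0 = ∫ y in y₁..y₂, F t y :=
    fun t ht => intervalIntegral.integral_congr fun y hyI =>
      (key t ht y (by rwa [uIcc_of_le hy.le] at hyI)).1
  rw [hI _ hmem.1, hI _ hmem.2, ← intervalIntegral.integral_sub (hint _) (hint _)]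
  refine intervalIntegral.integral_congr fun y hyI => ?_
  rw [uIcc_of_le hy.le] at hyI
  simp only [Function.comp_apply]
  rw [(key _ hmem.1 y hyI).2, (key _ hmem.2 y hyI).2]

lemma ExtendsToId.integral_zero_one {f : Plane → Plane} (hf : ExtendsToId f) {y₁ y₂ : ℝ}
    (hy1 : 0 ≤ y₁) (hy : y₁ ≤ y₂) (hy2 : y₂ ≤ 1) :
    (∫ y in y₁..y₂, f !₂[0, y] 0) = 0 ∧ (∫ y in y₁..y₂, f !₂[1, y] 0) = y₂ - y₁ := by
  have key : ∀ t : ℝ, t = 0 ∨ t = 1 → ∀ y ∈ uIcc y₁ y₂, f !₂[t, y] 0 = t := by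
    intro t ht y hyI
    rw [uIcc_of_le hy] at hyI
    have hmem : (!₂[t, y] : Plane) ∈ frontier unitSq := by
      rw [isOpen_unitSq.frontier_eq]
      refine ⟨mem_closure_unitSq ?_ ?_ (hy1.trans hyI.1) (hyI.2.trans hy2), fun h => ?_⟩
      · rcases ht with rfl | rfl <;> simp
      · rcases ht with rfl | rfl <;> simp
      · have h1 := h.1
        have h2 := h.2.1
        rcases ht with rfl | rfl
        · simp at h1
        · simp at h2
    rw [hf.2 hmem]
    rfl
  constructor
  · rw [intervalIntegral.integral_congr (g := fun _ => 0) (key 0 (Or.inl rfl))]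
    simp
  · rw [intervalIntegral.integral_congr (g := fun _ => 1) (key 1 (Or.inr rfl))]
    simp

/-- One of the two parity classes of increments carries at least half of the total increment. -/
lemma half_le_sum_even_or_odd (I : ℝ → ℝ) {k : ℕ} (hk : 1 ≤ k) :
    (I 1 - I 0) / 2 ≤ ∑ i : Fin k, (I ((2 * (i : ℕ) + 1) / (2 * k)) - I (2 * (i : ℕ) / (2 * k))) ∨
    (I 1 - I 0) / 2 ≤
      ∑ i : Fin k, (I ((2 * (i : ℕ) + 2) / (2 * k)) - I ((2 * (i : ℕ) + 1) / (2 * k))) := by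
  have hk0 : (k : ℝ) ≠ 0 := by positivity
  have h := Finset.sum_range_sub (fun i : ℕ => I (2 * i / (2 * k))) k
  have e1 : (2 * (k : ℝ) / (2 * k)) = 1 := div_self (by positivity)
  simp only [Nat.cast_zero, mul_zero, zero_div, Nat.cast_add, Nat.cast_one, mul_add, mul_one,
    e1] at h
  rw [← Fin.sum_univ_eq_sum_range
    (fun i => I ((2 * (i : ℝ) + 2) / (2 * k)) - I (2 * (i : ℝ) / (2 * k)))] at h
  by_contra! hlt
  have := add_lt_add hlt.1 hlt.2
  rw [← Finset.sum_add_distrib] at this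
  simp only [sub_add_sub_cancel'] at this
  linarith

/-- The set `A'_n` is dense. -/
lemma denseInX_An' (M : ℝ) {n : ℕ} (hn : 1 ≤ n) : DenseInX M (An' M n) := by
  refine ⟨fun p hp => hp.1, fun p hp ε hε => ?_⟩
  obtain ⟨-, hext, hBV, -⟩ := id hp
  have hn0 : (1 : ℝ) ≤ n := by exact_mod_cast hn
  have hnpos : (0 : ℝ) < 1 / n := by positivity
  have hn1 : 1 / (n : ℝ) ≤ 1 := by rw [div_le_one (by linarith)]; exact hn0
  set ν : ℝ := 1 / n with hν
  have hang : Real.pi * (1 - ν) / 2 < Real.pi / 2 := by nlinarith [Real.pi_pos]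
  have hang0 : 0 ≤ Real.pi * (1 - ν) / 2 := by
    have := mul_nonneg Real.pi_pos.le (sub_nonneg.2 hn1)
    linarith
  set κ : ℝ := Real.sin (Real.pi * (1 - ν) / 2) with hκ
  have hκ0 : 0 ≤ κ := Real.sin_nonneg_of_nonneg_of_le_pi hang0 (by linarith [Real.pi_pos])
  have hκ1 : κ < 1 := by
    rw [← Real.sin_pi_div_two]
    exact Real.sin_lt_sin_of_lt_of_le_pi_div_two (by linarith [Real.pi_pos]) le_rfl hang
  have harc : Real.arcsin κ = Real.pi * (1 - ν) / 2 :=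
    Real.arcsin_sin (by linarith [Real.pi_pos]) hang.le
  have hρ : 0 < ν / 8 := by linarith
  obtain ⟨C, hC⟩ := exists_abs_deriv_bump_le 0 1 hρ
  have hC0 : 0 ≤ C := (abs_nonneg _).trans (hC 0)
  obtain ⟨a, ha, hda⟩ := exists_forall_precomp_dX_lt hp hε hC0
  obtain ⟨k, hk, hka, hkC⟩ : ∃ k : ℕ, 1 ≤ k ∧ 1 / (2 * (k : ℝ)) ≤ a ∧
      κ + C * (1 / (2 * (k : ℝ))) < 1 := by
    obtain ⟨k, hk⟩ := exists_nat_one_div_lt (show 0 < min a ((1 - κ) / (C + 1)) from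
      lt_min ha (div_pos (by linarith) (by linarith)))
    have hle : 1 / (2 * ((k + 1 : ℕ) : ℝ)) ≤ 1 / ((k : ℝ) + 1) := by
      push_cast
      exact one_div_le_one_div_of_le (by positivity) (by linarith [k.cast_nonneg (α := ℝ)])
    have h1 := hk.trans_le (min_le_left _ _)
    have h2 := hk.trans_le (min_le_right _ _)
    rw [lt_div_iff₀ (by linarith)] at h2
    have h3 := mul_le_mul_of_nonneg_left hle hC0
    have h4 : 0 < 1 / ((k : ℝ) + 1) := by positivity
    exact ⟨k + 1, by omega, hle.trans h1.le, by linarith⟩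
  have hk0 : (0 : ℝ) < k := by exact_mod_cast hk
  have h := shearProfile_wave hκ0 hκ1 hk hρ hC hkC
  have hχ : ∀ y ∈ Icc (ν / 4) (1 - ν / 4), bump 0 1 (ν / 8) y = 1 := fun y hy =>
    bump_eq_one hρ ⟨by linarith [hy.1], by linarith [hy.2]⟩
  have hodd : ∀ i : ℕ, wave κ k ((2 * i + 1) / (2 * k)) = (1 - ν) / (2 * k) := fun i => by
    rw [wave_odd hk i, harc]
    field_simp
  have heven : ∀ i : ℕ, wave κ k (2 * i / (2 * k)) = 0 := wave_even hk
  have heven' : ∀ i : ℕ, wave κ k ((2 * i + 2) / (2 * k)) = 0 := fun i => by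
    have := heven (i + 1)
    rwa [Nat.cast_add, Nat.cast_one, mul_add, mul_one] at this
  have hvol : ∑ _i : Fin k, ν / (2 * k) = ν / 2 := by
    rw [Finset.sum_const, Finset.card_univ, Fintype.card_fin, nsmul_eq_mul]
    field_simp
  have hofReal : ENNReal.ofReal (ν / 2) < 1 / (n : ℝ≥0∞) := by
    have : (1 : ℝ≥0∞) / n = ENNReal.ofReal ν := by
      rw [hν, ENNReal.ofReal_div_of_pos (by linarith), ENNReal.ofReal_one, ENNReal.ofReal_natCast]
    rw [this]
    exact (ENNReal.ofReal_lt_ofReal_iff hnpos).2 (by linarith)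
  have hcast : ∀ i j : Fin k, i ≠ j →
      ((i : ℕ) : ℝ) + 1 ≤ ((j : ℕ) : ℝ) ∨ ((j : ℕ) : ℝ) + 1 ≤ ((i : ℕ) : ℝ) := by
    intro i j hij
    have : (i : ℕ) + 1 ≤ j ∨ (j : ℕ) + 1 ≤ i := by
      have := Fin.val_ne_of_ne hij
      omega
    exact_mod_cast this
  have hlast : ∀ i : Fin k, ((i : ℕ) : ℝ) + 1 ≤ k := fun i => by exact_mod_cast i.2
  obtain ⟨hI0, hI1⟩ := hext.integral_zero_one (y₁ := ν / 4) (y₂ := 1 - ν / 4) (by linarith)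
    (by linarith) (by linarith)
  have hhalf := half_le_sum_even_or_odd
    (fun t => ∫ y in (ν / 4)..(1 - ν / 4), p.1 !₂[t, y] 0) hk
  simp only [hI0, hI1] at hhalf
  rcases hhalf with hhalf | hhalf
  · obtain ⟨E, hE, hfin, hvolE, hvar⟩ := h.neg.exists_triangles_precomp hext hBV
      (y₁ := ν / 4) (y₂ := 1 - ν / 4) (by linarith) (by linarith) (by linarith) hχ
      (s := fun i : Fin k => 2 * ((i : ℕ) : ℝ) / (2 * k))
      (u := fun i : Fin k => (2 * ((i : ℕ) : ℝ) + 1) / (2 * k))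
      (fun i => by gcongr; linarith) (fun i => by positivity)
      (fun i => by rw [div_le_one (by positivity)]; linarith [hlast i])
      (fun i j hij => (hcast i j hij).imp (fun h => by gcongr; linarith)
        (fun h => by gcongr; linarith))
    obtain ⟨hX, hd⟩ := hda _ _ _ _ h.neg hka
    refine ⟨_, ⟨hX, E, hE, hfin, (hvolE.trans_eq ?_).trans_lt hofReal, ?_⟩, hd⟩
    · rw [← hvol]
      congr 1
      refine Finset.sum_congr rfl fun i _ => ?_
      simp only [hodd, heven]
      field_simp
      ring
    · rw [← hν]
      linarith
  · obtain ⟨E, hE, hfin, hvolE, hvar⟩ := h.exists_triangles_precomp hext hBV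
      (y₁ := ν / 4) (y₂ := 1 - ν / 4) (by linarith) (by linarith) (by linarith) hχ
      (s := fun i : Fin k => (2 * ((i : ℕ) : ℝ) + 1) / (2 * k))
      (u := fun i : Fin k => (2 * ((i : ℕ) : ℝ) + 2) / (2 * k))
      (fun i => by gcongr; linarith) (fun i => by positivity)
      (fun i => by rw [div_le_one (by positivity)]; linarith [hlast i])
      (fun i j hij => (hcast i j hij).imp
        (fun h => div_le_div_of_nonneg_right (by linarith) (by positivity))
        (fun h => div_le_div_of_nonneg_right (by linarith) (by positivity)))
    obtain ⟨hX, hd⟩ := hda _ _ _ _ h hka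
    refine ⟨_, ⟨hX, E, hE, hfin, (hvolE.trans_eq ?_).trans_lt hofReal, ?_⟩, hd⟩
    · rw [← hvol]
      congr 1
      refine Finset.sum_congr rfl fun i _ => ?_
      simp only [hodd, heven']
      field_simp
      ring
    · rw [← hν]
      linarith

/-- for every `n ≥ 1`, the set `A'_n` is open and dense in the metric
space `(X, d)`. -/
theorem An'_open_dense (M : ℝ) (hM : 2 < M) (n : ℕ) (hn : 1 ≤ n) :
    OpenInX M (An' M n) ∧ DenseInX M (An' M n) := by
  exact ⟨openInX_An' M n, denseInX_An' M hn⟩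

end
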